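/- Let l, r satisfy l ≥ r, l + r ≥ 0, 2l − r > 1/2, and 3l − 2r > 3/4, and let ε > 0 be sufficiently small. Then for any signs ±₀, ±₁, ±₂ and all Schwartz ψ₁, ψ₂ on ℝ^{1+3} one has the null form estimate ‖B_{±₁,±₂}(ψ₁, ψ₂)‖_{X^{r,−1/2+2ε}_{±₀}} ≲ ‖ψ₁‖_{X^{l,3/4+ε}_{±₁}} ‖ψ₂‖_{X^{l,3/4+ε}_{±₂}}. -/

import Mathlib

noncomputable section

open MeasureTheory Complex
open scoped FourierTransform RealInnerProductSpace BigOperators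

/-! ## Basic setup: space-time `ℝ^{1+3}` and Fourier analytic toolbox -/

/-- Space-time `ℝ^{1+3}` (used both for physical points `(t,x)` and
Fourier variables `(τ,ξ)`); coordinate `0` is time. -/
abbrev SpaceTime : Type := EuclideanSpace ℝ (Fin 4)

/-- Space `ℝ³`. -/
abbrev Space : Type := EuclideanSpace ℝ (Fin 3)

/-- The spatial part of a space-time point / frequency. -/
def spt (z : SpaceTime) : Space := (WithLp.equiv 2 (Fin 3 → ℝ)).symm fun i => z i.succ

/-- The space-time point `(t, x)`. -/
def stpt (t : ℝ) (x : Space) : SpaceTime :=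
  (WithLp.equiv 2 (Fin 4 → ℝ)).symm fun μ => Fin.cases t (fun i => x i) μ

/-- Japanese bracket `⟨x⟩ = (1+x²)^{1/2}`. -/
def jap (x : ℝ) : ℝ := Real.sqrt (1 + x ^ 2)

/-- The sign `±1` encoded by a boolean (`true ↦ +1`). -/
def sgnv (sg : Bool) : ℝ := if sg then 1 else -1

/-- Minkowski metric coefficient `η^{μμ}`, used to raise indices. -/
def mink (μ : Fin 4) : ℝ := if μ = 0 then -1 else 1

section Ops

variable {E : Type*} [NormedAddCommGroup E] [NormedSpace ℂ E]

/-- Space-time Fourier transform. -/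
def FT (u : SpaceTime → E) : SpaceTime → E := fun ζ => 𝓕 u ζ

/-- Inverse space-time Fourier transform. -/
def FTinv (u : SpaceTime → E) : SpaceTime → E := fun x => 𝓕⁻ u x

/-- Spatial Fourier transform. -/
def FT3 (u : Space → E) : Space → E := fun ξ => 𝓕 u ξ

/-- Inverse spatial Fourier transform. -/
def FT3inv (u : Space → E) : Space → E := fun x => 𝓕⁻ u x

/-- Weighted `L²`-norm (on the Fourier side). -/
def wnorm (w : SpaceTime → ℝ) (f : SpaceTime → E) : ℝ := (∫ ζ, (w ζ * ‖f ζ‖) ^ 2) ^ ((1:ℝ)/2)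

/-- Finiteness of the weighted `L²`-norm. -/
def wfin (w : SpaceTime → ℝ) (f : SpaceTime → E) : Prop :=
  MeasureTheory.HasFiniteIntegral (fun ζ => (w ζ * ‖f ζ‖) ^ 2) volume

/-- The weight of the wave-Sobolev space `H^{s,b}`. -/
def hWt (s b : ℝ) (ζ : SpaceTime) : ℝ := jap ‖spt ζ‖ ^ s * jap (|ζ 0| - ‖spt ζ‖) ^ b

/-- The weight of the space `X^{s,b}_±`. -/
def xWt (sg : Bool) (s b : ℝ) (ζ : SpaceTime) : ℝ :=
  jap ‖spt ζ‖ ^ s * jap (-(ζ 0) + sgnv sg * ‖spt ζ‖) ^ b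

/-- The norm of the wave-Sobolev space `H^{s,b}`:
`‖u‖ = ‖⟨ξ⟩^s ⟨|τ|-|ξ|⟩^b ũ(τ,ξ)‖_{L²}`. -/
def HsbNorm (s b : ℝ) (u : SpaceTime → E) : ℝ := wnorm (hWt s b) (FT u)

/-- Membership (finiteness of the norm) for `H^{s,b}`. -/
def HsbFin (s b : ℝ) (u : SpaceTime → E) : Prop := wfin (hWt s b) (FT u)

/-- The norm of `X^{s,b}_±` : `‖u‖ = ‖⟨ξ⟩^s ⟨-τ ± |ξ|⟩^b ũ(τ,ξ)‖_{L²}`. -/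
def XsbNorm (sg : Bool) (s b : ℝ) (u : SpaceTime → E) : ℝ := wnorm (xWt sg s b) (FT u)

/-- Membership (finiteness of the norm) for `X^{s,b}_±`. -/
def XsbFin (sg : Bool) (s b : ℝ) (u : SpaceTime → E) : Prop := wfin (xWt sg s b) (FT u)

/-- Fourier multiplier with (complex) symbol `m`. -/
def mult (m : SpaceTime → ℂ) (u : SpaceTime → E) : SpaceTime → E := FTinv fun ζ => m ζ • FT u ζ

/-- Fourier multiplier with real symbol `m`. -/
def rmult (m : SpaceTime → ℝ) (u : SpaceTime → E) : SpaceTime → E := mult (fun ζ => (m ζ : ℂ)) u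

/-- `Λ^α`, the multiplier with symbol `⟨ξ⟩^α`. -/
def Lam (α : ℝ) (u : SpaceTime → E) : SpaceTime → E := rmult (fun ζ => jap ‖spt ζ‖ ^ α) u

/-- `Λ₊^α`, the multiplier with symbol `⟨|τ|+|ξ|⟩^α`. -/
def LamPlus (α : ℝ) (u : SpaceTime → E) : SpaceTime → E := rmult (fun ζ => jap (|ζ 0| + ‖spt ζ‖) ^ α) u

/-- `Λ₋^α`, the multiplier with symbol `⟨|τ|-|ξ|⟩^α`. -/
def LamMinus (α : ℝ) (u : SpaceTime → E) : SpaceTime → E := rmult (fun ζ => jap (|ζ 0| - ‖spt ζ‖) ^ α) u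

/-- `D^α`, the multiplier with symbol `|ξ|^α`. -/
def Dop (α : ℝ) (u : SpaceTime → E) : SpaceTime → E := rmult (fun ζ => ‖spt ζ‖ ^ α) u

/-- `D₊^α`, the multiplier with symbol `(|τ|+|ξ|)^α`. -/
def DPlus (α : ℝ) (u : SpaceTime → E) : SpaceTime → E := rmult (fun ζ => (|ζ 0| + ‖spt ζ‖) ^ α) u

/-- `D₋^α`, the multiplier with symbol `||τ|-|ξ||^α`. -/
def DMinus (α : ℝ) (u : SpaceTime → E) : SpaceTime → E := rmult (fun ζ => |(|ζ 0| - ‖spt ζ‖)| ^ α) u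

/-- `|∇|`, the multiplier with symbol `|ξ|`. -/
def absNabla (u : SpaceTime → E) : SpaceTime → E := Dop 1 u

/-- The partial derivative `∂_μ` on space-time. -/
def pd (μ : Fin 4) (u : SpaceTime → E) : SpaceTime → E := fun x => fderiv ℝ u x (EuclideanSpace.single μ 1)

/-- The spatial partial derivative `∂_i` on `ℝ³`. -/
def pd3 (i : Fin 3) (u : Space → E) : Space → E := fun x => fderiv ℝ u x (EuclideanSpace.single i 1)

/-- The (inhomogeneous) Riesz transform `R_j = Λ^{-1} ∂_j`. -/
def Riesz (j : Fin 3) (u : SpaceTime → E) : SpaceTime → E := Lam (-1) (pd j.succ u)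

/-- The d'Alembertian `□ = ∂_t² - Δ`. -/
def box (u : SpaceTime → E) : SpaceTime → E :=
  fun x => pd 0 (pd 0 u) x - ∑ j : Fin 3, pd j.succ (pd j.succ u) x

/-- The `F^s` norm, `‖u‖_{F^s} = ‖Λ₊ u‖_{H^{s-1,3/4+ε}}`. -/
def FsNorm (ε s : ℝ) (u : SpaceTime → E) : ℝ := HsbNorm (s - 1) (3/4 + ε) (LamPlus 1 u)

/-- Membership in `F^s`. -/
def FsFin (ε s : ℝ) (u : SpaceTime → E) : Prop := HsbFin (s - 1) (3/4 + ε) (LamPlus 1 u)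

/-- The `G^r` norm, `‖v‖_{G^r} = ‖Λ₊ v‖_{H^{r-1,1/2+ε}}`. -/
def GrNorm (ε r : ℝ) (v : SpaceTime → E) : ℝ := HsbNorm (r - 1) (1/2 + ε) (LamPlus 1 v)

/-- Membership in `G^r`. -/
def GrFin (ε r : ℝ) (v : SpaceTime → E) : Prop := HsbFin (r - 1) (1/2 + ε) (LamPlus 1 v)

/-- The time slab `[0,T] × ℝ³`. -/
def slab (T : ℝ) : Set SpaceTime := {x | x 0 ∈ Set.Icc 0 T}

/-- `u` belongs to the restriction to `[0,T]` of the space with defining predicate `P`: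
it has an extension lying in that space. -/
def MemRestrict (P : (SpaceTime → E) → Prop) (T : ℝ) (u : SpaceTime → E) : Prop :=
  ∃ U : SpaceTime → E, P U ∧ Set.EqOn U u (slab T)

/-- The spatial Sobolev `H^s(ℝ³)` norm. -/
def HNorm (s : ℝ) (f : Space → E) : ℝ :=
  (∫ ξ, (jap ‖ξ‖ ^ s * ‖FT3 f ξ‖) ^ 2) ^ ((1:ℝ)/2)

/-- Membership in the spatial Sobolev space `H^s(ℝ³)`. -/
def MemHs (s : ℝ) (f : Space → E) : Prop :=
  MeasureTheory.HasFiniteIntegral (fun ξ => (jap ‖ξ‖ ^ s * ‖FT3 f ξ‖) ^ 2) volume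

/-- Continuity with values in `H^s` on the time interval `[0,T]` (for a space-time function). -/
def ContHsOn (s T : ℝ) (u : SpaceTime → E) : Prop :=
  (∀ t ∈ Set.Icc (0:ℝ) T, MemHs s fun ξ => u (stpt t ξ)) ∧
  ∀ t ∈ Set.Icc (0:ℝ) T,
    Filter.Tendsto (fun t' => HNorm s fun ξ => u (stpt t' ξ) - u (stpt t ξ))
      (nhdsWithin t (Set.Icc 0 T)) (nhds 0)

end Ops

/-- The angle weight `|∠(±₁ξ₁, ±₂ξ₂)|`. -/
def angleWt (sg1 sg2 : Bool) (η θ : SpaceTime) : ℝ :=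
  |InnerProductGeometry.angle (sgnv sg1 • spt η) (sgnv sg2 • spt θ)|

/-- The bilinear null-form operator `B_{±₁,±₂}`, defined by its space-time Fourier transform
`𝓕(B(u,v))(ζ) = ∫ |∠(±₁ξ₁, ±₂ξ₂)| ũ(ζ₁) ṽ(ζ-ζ₁) dζ₁`. -/
def Bop (sg1 sg2 : Bool) (u v : SpaceTime → ℂ) : SpaceTime → ℂ :=
  FTinv fun ζ => ∫ η, (angleWt sg1 sg2 η (ζ - η) : ℂ) * FT u η * FT v (ζ - η)

/-! ## Null forms -/

/-- The null form `Q₀(u,v) = ∂_α u ∂^α v`. -/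
def Q0f (u v : SpaceTime → ℂ) : SpaceTime → ℂ := fun x => ∑ μ : Fin 4, mink μ • (pd μ u x * pd μ v x)

/-- The null form `Q_{αβ}(u,v) = ∂_α u ∂_β v - ∂_β u ∂_α v`. -/
def Qf (α β : Fin 4) (u v : SpaceTime → ℂ) : SpaceTime → ℂ :=
  fun x => pd α u x * pd β v x - pd β u x * pd α v x

/-! ## Matrix-valued (Lie algebra) objects -/

/-- `n×n` complex matrices, the ambient space of `su(n,ℂ)`. -/
abbrev G (n : ℕ) : Type := Matrix (Fin n) (Fin n) ℂ

attribute [local instance] Matrix.frobeniusNormedAddCommGroup Matrix.frobeniusNormedSpace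

/-- Membership in the Lie algebra `su(n,ℂ)` (trace-free skew-hermitian matrices). -/
def IsSu {n : ℕ} (X : G n) : Prop := X.conjTranspose = -X ∧ X.trace = 0

/-- The matrix commutator `[X,Y] = XY - YX`. -/
def mcomm {n : ℕ} (X Y : G n) : G n := X * Y - Y * X

/-- The commutator null form `Q_{αβ}[u,v] = [∂_α u, ∂_β v] - [∂_β u, ∂_α v]`. -/
def Qc {n : ℕ} (α β : Fin 4) (u v : SpaceTime → G n) : SpaceTime → G n :=
  fun x => mcomm (pd α u x) (pd β v x) - mcomm (pd β u x) (pd α v x)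

/-- The commutator null form `Q₀[u,v] = [∂_α u, ∂^α v]`. -/
def Q0c {n : ℕ} (u v : SpaceTime → G n) : SpaceTime → G n :=
  fun x => ∑ μ : Fin 4, mink μ • mcomm (pd μ u x) (pd μ v x)

/-! ## Dirac operators -/

/-- The spinor space `ℂ⁴`. -/
abbrev C4 : Type := EuclideanSpace ℂ (Fin 4)

/-- A `4×4` matrix acting on `ℂ⁴`. -/
def matAct (M : Matrix (Fin 4) (Fin 4) ℂ) (v : C4) : C4 :=
  (WithLp.equiv 2 (Fin 4 → ℂ)).symm (M.mulVec ((WithLp.equiv 2 (Fin 4 → ℂ)) v))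

/-- The Dirac matrices `α^0 = I`, `α^j = ((0,σ^j),(σ^j,0))`. -/
def alphaMat : Fin 4 → Matrix (Fin 4) (Fin 4) ℂ
  | 0 => 1
  | 1 => !![0,0,0,1; 0,0,1,0; 0,1,0,0; 1,0,0,0]
  | 2 => !![0,0,0,-I; 0,0,I,0; 0,-I,0,0; I,0,0,0]
  | 3 => !![0,0,1,0; 0,0,0,-1; 1,0,0,0; 0,-1,0,0]

/-- Matrix-symbol Fourier multiplier on spinor fields (space-time). -/
def multM (m : SpaceTime → Matrix (Fin 4) (Fin 4) ℂ) (u : SpaceTime → C4) : SpaceTime → C4 :=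
  FTinv fun ζ => matAct (m ζ) (FT u ζ)

/-- Matrix-symbol Fourier multiplier on spinor fields (space). -/
def multM3 (m : Space → Matrix (Fin 4) (Fin 4) ℂ) (u : Space → C4) : Space → C4 :=
  FT3inv fun ξ => matAct (m ξ) (FT3 u ξ)

/-- The symbol `Π(±ξ) = ½(I ± ξ_j α^j / |ξ|)` of the Dirac projections. -/
def PiSymb (sg : Bool) (ξ : Space) : Matrix (Fin 4) (Fin 4) ℂ :=
  (2⁻¹ : ℂ) • (1 + ∑ j : Fin 3, ((sgnv sg * ξ j / ‖ξ‖ : ℝ) : ℂ) • alphaMat j.succ)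

/-- The Dirac projection `Π_± = Π_±(∇/i)` (space-time version). -/
def PiProj (sg : Bool) (u : SpaceTime → C4) : SpaceTime → C4 := multM (fun ζ => PiSymb sg (spt ζ)) u

/-- The Dirac projection `Π_± = Π_±(∇/i)` acting on functions of the space variable. -/
def PiProj3 (sg : Bool) (u : Space → C4) : Space → C4 := multM3 (fun ξ => PiSymb sg ξ) u

open scoped ENNReal NNReal

theorem lintegral_prod_sq_add_sq (g : ℝ → ℝ≥0∞) (hg : Measurable g) :
    ∫⁻ p : ℝ × ℝ, g (p.1 ^ 2 + p.2 ^ 2)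
      = ENNReal.ofReal (2 * Real.pi) * ∫⁻ r in Set.Ioi (0 : ℝ), ENNReal.ofReal r * g (r ^ 2) := by
  rw [← lintegral_comp_polarCoord_symm]
  have h1 : ∀ p : ℝ × ℝ, ENNReal.ofReal p.1 • g ((polarCoord.symm p).1 ^ 2 + (polarCoord.symm p).2 ^ 2)
      = ENNReal.ofReal p.1 * g (p.1 ^ 2) := by
    intro p
    have : (p.1 * Real.cos p.2) ^ 2 + (p.1 * Real.sin p.2) ^ 2 = p.1 ^ 2 := by
      have := Real.cos_sq_add_sin_sq p.2
      linear_combination p.1 ^ 2 * this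
    simp [polarCoord_symm_apply, this]
  simp only [h1]
  rw [polarCoord_target, Measure.volume_eq_prod, ← Measure.prod_restrict,
    lintegral_prod _ (by fun_prop)]
  simp only [lintegral_const, Measure.restrict_apply_univ, Real.volume_Ioo]
  rw [lintegral_mul_const _ (by fun_prop), mul_comm]
  congr 2
  ring

theorem lintegral_space_eq (h : Space → ℝ≥0∞) (hh : Measurable h) :
    ∫⁻ ξ : Space, h ξ = ∫⁻ x : ℝ, ∫⁻ p : ℝ × ℝ, h !₂[x, p.1, p.2] := by
  rw [← (PiLp.volume_preserving_toLp (Fin 3)).lintegral_comp hh,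
    ← ((volume_preserving_piFinSuccAbove (fun _ : Fin 3 => ℝ) 0).symm _).lintegral_comp (by fun_prop),
    Measure.volume_eq_prod, lintegral_prod _ (by fun_prop)]
  refine lintegral_congr fun x => ?_
  rw [← ((volume_preserving_finTwoArrow ℝ).symm _).lintegral_comp (by fun_prop)]
  refine lintegral_congr fun p => ?_
  congr 2
  ext i
  fin_cases i <;> rfl

theorem lintegral_spaceTime_eq (h : SpaceTime → ℝ≥0∞) (hh : Measurable h) :
    ∫⁻ ζ : SpaceTime, h ζ = ∫⁻ τ : ℝ, ∫⁻ ξ : Space, h (stpt τ ξ) := by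
  rw [← (PiLp.volume_preserving_toLp (Fin 4)).lintegral_comp hh,
    ← ((volume_preserving_piFinSuccAbove (fun _ : Fin 4 => ℝ) 0).symm _).lintegral_comp (by fun_prop),
    Measure.volume_eq_prod, lintegral_prod _ (by fun_prop)]
  refine lintegral_congr fun x => ?_
  rw [← (PiLp.volume_preserving_ofLp (Fin 3)).lintegral_comp (by fun_prop)]
  refine lintegral_congr fun p => ?_
  congr 2
  ext i
  refine Fin.cases ?_ (fun i => ?_) i <;> rfl

theorem lintegral_Ioi_mul_comp_sqrt_le (x : ℝ) (h : ℝ → ℝ≥0∞) :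
    ∫⁻ r in Set.Ioi (0 : ℝ), ENNReal.ofReal r * h (Real.sqrt (x ^ 2 + r ^ 2))
      ≤ ∫⁻ ρ in Set.Ioi (0 : ℝ), ENNReal.ofReal ρ * h ρ := by
  have hpos : ∀ r ∈ Set.Ioi (0 : ℝ), 0 < x ^ 2 + r ^ 2 := fun r hr => by
    have : 0 < r ^ 2 := pow_pos hr 2
    positivity
  have hd : ∀ r ∈ Set.Ioi (0 : ℝ), HasDerivWithinAt (fun r => Real.sqrt (x ^ 2 + r ^ 2))
      (r / Real.sqrt (x ^ 2 + r ^ 2)) (Set.Ioi 0) r := by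
    intro r hr
    have h1 : HasDerivAt (fun r : ℝ => x ^ 2 + r ^ 2) (2 * r) r := by
      simpa using (hasDerivAt_pow 2 r).const_add (x ^ 2)
    have h2 := (h1.sqrt (hpos r hr).ne').hasDerivWithinAt (s := Set.Ioi 0)
    rwa [mul_div_mul_left _ _ two_ne_zero] at h2
  have hinj : Set.InjOn (fun r => Real.sqrt (x ^ 2 + r ^ 2)) (Set.Ioi 0) := by
    intro r hr s hs hrs
    have := (Real.sqrt_inj (hpos r hr).le (hpos s hs).le).1 hrs
    have h2 : r ^ 2 = s ^ 2 := by linarith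
    exact (pow_left_inj₀ (le_of_lt hr) (le_of_lt hs) two_ne_zero).1 h2
  have key := lintegral_image_eq_lintegral_abs_deriv_mul measurableSet_Ioi hd hinj
    (fun ρ => ENNReal.ofReal ρ * h ρ)
  have hle : ∫⁻ ρ in (fun r => Real.sqrt (x ^ 2 + r ^ 2)) '' Set.Ioi 0, ENNReal.ofReal ρ * h ρ
      ≤ ∫⁻ ρ in Set.Ioi (0 : ℝ), ENNReal.ofReal ρ * h ρ := by
    refine lintegral_mono_set ?_
    rintro _ ⟨r, hr, rfl⟩
    exact Real.sqrt_pos.2 (hpos r hr)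
  refine le_trans (le_of_eq ?_) hle
  rw [key]
  refine setLIntegral_congr_fun measurableSet_Ioi fun r hr => ?_
  have hs := Real.sqrt_pos.2 (hpos r hr)
  have hr' : 0 < r := hr
  rw [← mul_assoc, ← ENNReal.ofReal_mul (abs_nonneg _), abs_of_pos (by positivity),
    div_mul_cancel₀ _ hs.ne']

theorem lintegral_comp_sqrt_affine_le {a : ℝ} (ha : 0 < a) (c : ℝ) (h : ℝ → ℝ≥0∞) :
    ∫⁻ x in {x : ℝ | 0 < c - 2 * a * x}, h (Real.sqrt (c - 2 * a * x))
      ≤ ENNReal.ofReal (1 / a) * ∫⁻ σ in Set.Ioi (0 : ℝ), ENNReal.ofReal σ * h σ := by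
  set S : Set ℝ := {x : ℝ | 0 < c - 2 * a * x} with hS
  have hSm : MeasurableSet S := measurableSet_lt (by fun_prop) (by fun_prop)
  have hd : ∀ r ∈ S, HasDerivWithinAt (fun r => Real.sqrt (c - 2 * a * r))
      (-a / Real.sqrt (c - 2 * a * r)) S r := by
    intro r hr
    have h1 : HasDerivAt (fun r : ℝ => c - 2 * a * r) (-(2 * a)) r := by
      simpa using ((hasDerivAt_id r).const_mul (2 * a)).const_sub c
    have h2 := (h1.sqrt (ne_of_gt hr)).hasDerivWithinAt (s := S)
    rwa [← mul_neg, mul_div_mul_left _ _ two_ne_zero] at h2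
  have hinj : Set.InjOn (fun r => Real.sqrt (c - 2 * a * r)) S := by
    intro r hr s hs hrs
    have := (Real.sqrt_inj (le_of_lt hr) (le_of_lt hs)).1 hrs
    have h2 : a * r = a * s := by linarith
    exact mul_left_cancel₀ ha.ne' h2
  have key := lintegral_image_eq_lintegral_abs_deriv_mul hSm hd hinj
    (fun ρ => ENNReal.ofReal ρ * h ρ)
  have hle : ∫⁻ ρ in (fun r => Real.sqrt (c - 2 * a * r)) '' S, ENNReal.ofReal ρ * h ρ
      ≤ ∫⁻ ρ in Set.Ioi (0 : ℝ), ENNReal.ofReal ρ * h ρ := by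
    refine lintegral_mono_set ?_
    rintro _ ⟨r, hr, rfl⟩
    exact Real.sqrt_pos.2 hr
  refine le_trans (le_of_eq ?_) (mul_le_mul_right hle _)
  rw [key, ← lintegral_const_mul' _ _ ENNReal.ofReal_ne_top]
  refine setLIntegral_congr_fun hSm fun r hr => ?_
  have hs : 0 < Real.sqrt (c - 2 * a * r) := Real.sqrt_pos.2 hr
  rw [← mul_assoc, ← mul_assoc, ← ENNReal.ofReal_mul (by positivity),
    ← ENNReal.ofReal_mul (by positivity), abs_div, abs_neg, abs_of_pos ha, abs_of_pos hs]
  have : 1 / a * (a / √(c - 2 * a * r)) * √(c - 2 * a * r) = 1 := by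
    rw [one_div_mul_eq_div, div_div_cancel_left' ha.ne', inv_mul_cancel₀ hs.ne']
  rw [this, ENNReal.ofReal_one, one_mul]

theorem lintegral_bipolar_axis_le {a : ℝ} (ha : 0 < a) (h : ℝ → ℝ → ℝ≥0∞)
    (hh : Measurable (Function.uncurry h)) :
    ∫⁻ ξ : Space, h ‖ξ‖ ‖ξ - !₂[a, 0, 0]‖ ≤ ENNReal.ofReal (2 * Real.pi / a) *
      ∫⁻ ρ in Set.Ioi (0 : ℝ), ∫⁻ σ in Set.Ioi (0 : ℝ),
        ENNReal.ofReal ρ * (ENNReal.ofReal σ * h ρ σ) := by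
  have hh' : ∀ {α : Type} [MeasurableSpace α] {f g : α → ℝ}, Measurable f → Measurable g →
      Measurable fun x => h (f x) (g x) := fun hf hg => hh.comp (hf.prodMk hg)
  set k : ℝ → ℝ → ℝ≥0∞ := fun x ρ =>
    Set.indicator {x : ℝ | 0 < (ρ ^ 2 + a ^ 2) - 2 * a * x}
      (fun x => h ρ (Real.sqrt ((ρ ^ 2 + a ^ 2) - 2 * a * x))) x with hk
  have hkm : Measurable (Function.uncurry k) := by
    have : Function.uncurry k = Set.indicator
        {p : ℝ × ℝ | 0 < (p.2 ^ 2 + a ^ 2) - 2 * a * p.1}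
        (fun p => h p.2 (Real.sqrt ((p.2 ^ 2 + a ^ 2) - 2 * a * p.1))) := by
      ext p
      simp [k, Function.uncurry, Set.indicator]
    rw [this]
    exact (hh' (by fun_prop) (by fun_prop)).indicator
      (measurableSet_lt (by fun_prop) (by fun_prop))
  rw [lintegral_space_eq _ (hh' (by fun_prop) (by fun_prop))]
  have hn : ∀ (x : ℝ) (p : ℝ × ℝ), h ‖(!₂[x, p.1, p.2] : Space)‖ ‖(!₂[x, p.1, p.2] : Space) - !₂[a, 0, 0]‖
      = h (Real.sqrt (x ^ 2 + (p.1 ^ 2 + p.2 ^ 2)))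
        (Real.sqrt ((x - a) ^ 2 + (p.1 ^ 2 + p.2 ^ 2))) := by
    intro x p
    simp [EuclideanSpace.norm_eq, Fin.sum_univ_three, add_assoc]
  simp only [hn]
  have h1 : ∀ x : ℝ, ∫⁻ p : ℝ × ℝ, h (Real.sqrt (x ^ 2 + (p.1 ^ 2 + p.2 ^ 2)))
        (Real.sqrt ((x - a) ^ 2 + (p.1 ^ 2 + p.2 ^ 2)))
      ≤ ENNReal.ofReal (2 * Real.pi) * ∫⁻ ρ in Set.Ioi (0 : ℝ), ENNReal.ofReal ρ * k x ρ := by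
    intro x
    rw [lintegral_prod_sq_add_sq (fun q => h (Real.sqrt (x ^ 2 + q)) (Real.sqrt ((x - a) ^ 2 + q)))
      (hh' (by fun_prop) (by fun_prop))]
    refine mul_le_mul_right ?_ _
    refine le_trans (le_of_eq ?_) (lintegral_Ioi_mul_comp_sqrt_le x (k x))
    refine setLIntegral_congr_fun measurableSet_Ioi fun r hr => ?_
    have hr2 : 0 < r ^ 2 := pow_pos hr 2
    have e : Real.sqrt (x ^ 2 + r ^ 2) ^ 2 + a ^ 2 - 2 * a * x = (x - a) ^ 2 + r ^ 2 := by
      rw [Real.sq_sqrt (by positivity)]; ring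
    simp only [k]
    rw [Set.indicator_of_mem (by simp only [Set.mem_ofPred_eq]; rw [e]; positivity), e]
  calc _ ≤ ∫⁻ x : ℝ, ENNReal.ofReal (2 * Real.pi) *
        ∫⁻ ρ in Set.Ioi (0 : ℝ), ENNReal.ofReal ρ * k x ρ := lintegral_mono h1
    _ = ENNReal.ofReal (2 * Real.pi) * ∫⁻ ρ in Set.Ioi (0 : ℝ), ENNReal.ofReal ρ * ∫⁻ x : ℝ, k x ρ := by
        rw [lintegral_const_mul' _ _ ENNReal.ofReal_ne_top, lintegral_lintegral_swap
          (by apply Measurable.aemeasurable; fun_prop)]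
        simp_rw [lintegral_const_mul' _ _ ENNReal.ofReal_ne_top]
    _ ≤ ENNReal.ofReal (2 * Real.pi) * ∫⁻ ρ in Set.Ioi (0 : ℝ), ENNReal.ofReal ρ *
          (ENNReal.ofReal (1 / a) * ∫⁻ σ in Set.Ioi (0 : ℝ), ENNReal.ofReal σ * h ρ σ) := by
        gcongr with ρ
        rw [lintegral_indicator (measurableSet_lt (by fun_prop) (by fun_prop))]
        exact lintegral_comp_sqrt_affine_le ha _ (h ρ)
    _ = _ := by
        simp_rw [lintegral_const_mul' _ _ ENNReal.ofReal_ne_top, mul_left_comm (ENNReal.ofReal _) (ENNReal.ofReal (1 / a))]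
        rw [lintegral_const_mul' _ _ ENNReal.ofReal_ne_top, ← mul_assoc, ← ENNReal.ofReal_mul (by positivity)]
        congr 2
        ring

/-- Integration in bipolar coordinates: in `ℝ³` the volume element is `2π ρσ/|z| dρ dσ`,
where `ρ = |ξ|` and `σ = |ξ - z|`. -/
theorem lintegral_bipolar_le {z : Space} (hz : z ≠ 0) (h : ℝ → ℝ → ℝ≥0∞)
    (hh : Measurable (Function.uncurry h)) :
    ∫⁻ ξ : Space, h ‖ξ‖ ‖ξ - z‖ ≤ ENNReal.ofReal (2 * Real.pi / ‖z‖) *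
      ∫⁻ ρ in Set.Ioi (0 : ℝ), ∫⁻ σ in Set.Ioi (0 : ℝ),
        ENNReal.ofReal ρ * (ENNReal.ofReal σ * h ρ σ) := by
  have ha : 0 < ‖z‖ := norm_pos_iff.2 hz
  set w : Space := !₂[‖z‖, 0, 0] with hw
  have hzw : ‖z‖ = ‖w‖ := by
    simp [hw, EuclideanSpace.norm_eq, Fin.sum_univ_three]
  set R := (Submodule.span ℝ {z - w})ᗮ.reflection
  have hR : R z = w := Submodule.reflection_sub hzw
  refine le_trans (le_of_eq ?_) (lintegral_bipolar_axis_le ha h hh)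
  have hm : Measurable fun ξ : Space => h ‖ξ‖ ‖ξ - w‖ :=
    hh.comp (Measurable.prodMk (by fun_prop) (by fun_prop))
  rw [← R.measurePreserving.lintegral_comp hm]
  refine lintegral_congr fun ξ => ?_
  rw [R.norm_map, ← hR, ← map_sub, R.norm_map]

theorem jap_pos (x : ℝ) : 0 < jap x := Real.sqrt_pos.2 (by positivity)

theorem one_le_jap (x : ℝ) : 1 ≤ jap x := Real.one_le_sqrt.2 (by nlinarith [sq_nonneg x])

@[fun_prop]
theorem continuous_jap : Continuous jap := by unfold jap; fun_prop

@[fun_prop]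
theorem continuous_spt : Continuous spt := by
  change Continuous fun z : SpaceTime => WithLp.toLp 2 (fun i : Fin 3 => z i.succ)
  fun_prop

theorem spt_neg (z : SpaceTime) : spt (-z) = -spt z := rfl
theorem spt_add (z w : SpaceTime) : spt (z + w) = spt z + spt w := rfl
theorem spt_sub (z w : SpaceTime) : spt (z - w) = spt z - spt w := rfl
theorem spt_stpt (t : ℝ) (x : Space) : spt (stpt t x) = x := rfl
theorem stpt_zero (t : ℝ) (x : Space) : stpt t x 0 = t := rfl

/-- The argument `-τ + s|ξ|` of the modulation weight. -/
def modu (s : ℝ) (ζ : SpaceTime) : ℝ := -(ζ 0) + s * ‖spt ζ‖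

@[fun_prop]
theorem continuous_modu (s : ℝ) : Continuous (modu s) := by unfold modu; fun_prop

theorem modu_neg (s : ℝ) (ζ : SpaceTime) : modu s (-ζ) = -modu (-s) ζ := by
  simp [modu, spt_neg]
  ring

theorem jap_neg (x : ℝ) : jap (-x) = jap x := by simp [jap]

theorem jap_modu_neg (s : ℝ) (ζ : SpaceTime) : jap (modu s (-ζ)) = jap (modu (-s) ζ) := by
  rw [modu_neg, jap_neg]

/-- The power `⟨x⟩^{-p}` as an extended nonnegative real. -/
def japPow (p x : ℝ) : ℝ≥0∞ := ENNReal.ofReal (jap x ^ (-p))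

@[fun_prop]
theorem measurable_japPow (p : ℝ) : Measurable (japPow p) := by unfold japPow; fun_prop

theorem japPow_sq (p x : ℝ) : japPow p x ^ 2 = japPow (2 * p) x := by
  rw [japPow, japPow, ← ENNReal.ofReal_pow (Real.rpow_nonneg (jap_pos x).le _), ← Real.rpow_natCast,
    ← Real.rpow_mul (jap_pos x).le]
  congr 2
  push_cast
  ring

theorem lintegral_japPow_lt_top {p : ℝ} (hp : 1 < p) : ∫⁻ x, japPow p x < ∞ := by
  have h := integrable_rpow_neg_one_add_norm_sq (E := ℝ) (μ := volume) (r := p) (by simpa using hp)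
  refine lt_of_le_of_lt (lintegral_mono fun x => ?_) h.lintegral_lt_top
  rw [japPow, jap, Real.sqrt_eq_rpow, ← Real.rpow_mul (by positivity), Real.norm_eq_abs, sq_abs]
  refine le_of_eq ?_
  congr 2
  ring

theorem lintegral_comp_add_mul_sign {s : ℝ} (hs : |s| = 1) (c : ℝ) (q : ℝ → ℝ≥0∞) :
    ∫⁻ σ, q (c + s * σ) = ∫⁻ x, q x := by
  rcases eq_or_eq_neg_of_abs_eq hs with rfl | rfl
  · simp only [one_mul]
    exact lintegral_add_left_eq_self q c
  · simp only [neg_one_mul, ← sub_eq_add_neg]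
    exact lintegral_sub_left_eq_self q c

theorem lintegral_two_cones_le {s s' : ℝ} (hs' : |s'| = 1)
    {q : ℝ → ℝ≥0∞} (hq : Measurable q) {w : ℝ → ℝ≥0∞} (hw : Measurable w) {A : ℝ}
    (z : SpaceTime) {K : SpaceTime → ℝ≥0∞}
    (hK : ∀ ζ, K ζ ≠ 0 → ‖spt (ζ - z)‖ ≤ A * ‖spt z‖ ∧
      K ζ ≤ w ‖spt ζ‖ * (q (modu s ζ) * q (modu s' (ζ - z)))) :
    ∫⁻ ζ, K ζ ≤ ENNReal.ofReal (2 * Real.pi * A) *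
      ((∫⁻ x, q x) ^ 2 * ∫⁻ ρ in Set.Ioi (0 : ℝ), ENNReal.ofReal ρ * w ρ) := by
  set a := ‖spt z‖ with ha
  set k : ℝ → ℝ → ℝ → ℝ≥0∞ := fun τ ρ σ => (Set.Iic (A * a)).indicator
    (fun σ => w ρ * (q (-τ + s * ρ) * q (-(τ - z 0) + s' * σ))) σ with hk
  have hkm : Measurable fun p : ℝ × ℝ × ℝ => k p.1 p.2.1 p.2.2 := by
    have : (fun p : ℝ × ℝ × ℝ => k p.1 p.2.1 p.2.2) = Set.indicator {p | p.2.2 ≤ A * a}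
        (fun p => w p.2.1 * (q (-p.1 + s * p.2.1) * q (-(p.1 - z 0) + s' * p.2.2))) := by
      ext p
      simp [k, Set.indicator]
    rw [this]
    exact Measurable.indicator (by fun_prop) (measurableSet_le (by fun_prop) (by fun_prop))
  have hK1 : ∀ ζ, K ζ ≤ k (ζ 0) ‖spt ζ‖ ‖spt ζ - spt z‖ := by
    intro ζ
    by_cases h0 : K ζ = 0
    · simp [h0]
    · obtain ⟨h1, h2⟩ := hK ζ h0
      simp only [k]
      rw [Set.indicator_of_mem (by simpa [spt_sub] using h1)]
      simpa [modu, spt_sub] using h2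
  have hm : Measurable fun ζ : SpaceTime => k (ζ 0) ‖spt ζ‖ ‖spt ζ - spt z‖ :=
    hkm.comp (f := fun ζ : SpaceTime => (ζ 0, ‖spt ζ‖, ‖spt ζ - spt z‖)) (by fun_prop)
  refine (lintegral_mono hK1).trans ?_
  rw [lintegral_spaceTime_eq _ hm]
  simp only [spt_stpt, stpt_zero]
  by_cases hz : spt z = 0
  · have ha0 : a = 0 := by rw [ha, hz, norm_zero]
    have : ∀ τ : ℝ, ∫⁻ ξ : Space, k τ ‖ξ‖ ‖ξ - spt z‖ = 0 := by
      intro τ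
      rw [← lintegral_zero (μ := (volume : Measure Space))]
      refine lintegral_congr_ae ?_
      filter_upwards [compl_mem_ae_iff.2 (measure_singleton (0 : Space))] with ξ hξ
      have : 0 < ‖ξ‖ := norm_pos_iff.2 hξ
      simp only [k]
      rw [Set.indicator_of_notMem]
      simpa [ha0, hz] using hξ
    simp [this]
  have hapos : 0 < a := norm_pos_iff.2 hz
  have h1 : ∀ τ : ℝ, ∫⁻ ξ : Space, k τ ‖ξ‖ ‖ξ - spt z‖ ≤ ENNReal.ofReal (2 * Real.pi * A) *
      ∫⁻ ρ in Set.Ioi (0 : ℝ), ENNReal.ofReal ρ * w ρ * q (-τ + s * ρ) * ∫⁻ x, q x := by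
    intro τ
    refine (lintegral_bipolar_le hz (k τ)
      (hkm.comp (f := fun p : ℝ × ℝ => (τ, p.1, p.2)) (by fun_prop))).trans ?_
    have h2 : ∀ ρ, ∫⁻ σ in Set.Ioi (0 : ℝ), ENNReal.ofReal ρ * (ENNReal.ofReal σ * k τ ρ σ)
        ≤ ENNReal.ofReal (A * a) * (ENNReal.ofReal ρ * w ρ * q (-τ + s * ρ) * ∫⁻ x, q x) := by
      intro ρ
      rw [← lintegral_comp_add_mul_sign hs' (-(τ - z 0)) q, ← lintegral_const_mul _ (by fun_prop),
        ← lintegral_const_mul _ (by fun_prop)]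
      refine (setLIntegral_le_lintegral _ _).trans (lintegral_mono fun σ => ?_)
      by_cases hσ : σ ∈ Set.Iic (A * a)
      · simp only [k]
        rw [Set.indicator_of_mem hσ]
        calc _ ≤ ENNReal.ofReal ρ * (ENNReal.ofReal (A * a) *
            (w ρ * (q (-τ + s * ρ) * q (-(τ - z 0) + s' * σ)))) := by
              have := ENNReal.ofReal_le_ofReal (Set.mem_Iic.1 hσ)
              gcongr
          _ = _ := by ring
      · simp only [k]
        rw [Set.indicator_of_notMem hσ]
        simp
    calc _ ≤ ENNReal.ofReal (2 * Real.pi / a) * ∫⁻ ρ in Set.Ioi (0 : ℝ),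
          ENNReal.ofReal (A * a) * (ENNReal.ofReal ρ * w ρ * q (-τ + s * ρ) * ∫⁻ x, q x) := by
          gcongr with ρ
          exact h2 ρ
      _ = _ := by
          rw [lintegral_const_mul' _ _ ENNReal.ofReal_ne_top, ← mul_assoc,
            ← ENNReal.ofReal_mul (by positivity)]
          congr 2
          field_simp
  calc _ ≤ ∫⁻ τ : ℝ, ENNReal.ofReal (2 * Real.pi * A) *
      ∫⁻ ρ in Set.Ioi (0 : ℝ), ENNReal.ofReal ρ * w ρ * q (-τ + s * ρ) * ∫⁻ x, q x :=
        lintegral_mono h1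
    _ = ENNReal.ofReal (2 * Real.pi * A) * ∫⁻ ρ in Set.Ioi (0 : ℝ),
        (ENNReal.ofReal ρ * w ρ) * (∫⁻ x, q x) ^ 2 := by
        rw [lintegral_const_mul' _ _ ENNReal.ofReal_ne_top, lintegral_lintegral_swap
          (by apply Measurable.aemeasurable; fun_prop)]
        congr 1
        refine lintegral_congr fun ρ => ?_
        rw [lintegral_mul_const _ (by fun_prop), lintegral_const_mul _ (by fun_prop)]
        have : ∫⁻ τ, q (-τ + s * ρ) = ∫⁻ x, q x := by
          rw [← lintegral_comp_add_mul_sign (s := -1) (by simp) (s * ρ) q]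
          refine lintegral_congr fun τ => ?_
          congr 1; ring
        rw [this]; ring
    _ = _ := by
        rw [lintegral_mul_const _ (by fun_prop), mul_comm (∫⁻ ρ in Set.Ioi (0 : ℝ), _)]

/-- The `L²` norm of an extended nonnegative function. -/
def l2n {α : Type*} [MeasureSpace α] (f : α → ℝ≥0∞) : ℝ≥0∞ := (∫⁻ x, f x ^ 2) ^ (1 / 2 : ℝ)

theorem l2n_sq {α : Type*} [MeasureSpace α] (f : α → ℝ≥0∞) : l2n f ^ 2 = ∫⁻ x, f x ^ 2 := by
  rw [l2n, ← ENNReal.rpow_natCast, ← ENNReal.rpow_mul]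
  norm_num

theorem lintegral_mul_le_l2n {α : Type*} [MeasureSpace α] {f g : α → ℝ≥0∞}
    (hf : Measurable f) (hg : Measurable g) : ∫⁻ x, f x * g x ≤ l2n f * l2n g := by
  have h := ENNReal.lintegral_mul_le_Lp_mul_Lq volume (Real.HolderConjugate.two_two)
    hf.aemeasurable hg.aemeasurable
  simpa [l2n] using h

/-- Integration over the triples `(ζ₀, ζ₁, ζ₂)` of sum zero. -/
def tri (G : SpaceTime → SpaceTime → SpaceTime → ℝ≥0∞) : ℝ≥0∞ :=
  ∫⁻ a, ∫⁻ b, G (-(a + b)) a b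

/-- Joint measurability of a function of three space-time variables. -/
def Meas3 (G : SpaceTime → SpaceTime → SpaceTime → ℝ≥0∞) : Prop :=
  Measurable fun p : SpaceTime × SpaceTime × SpaceTime => G p.1 p.2.1 p.2.2

theorem Meas3.comp {G : SpaceTime → SpaceTime → SpaceTime → ℝ≥0∞} (hG : Meas3 G) {α : Type*}
    [MeasurableSpace α] {f g h : α → SpaceTime} (hf : Measurable f) (hg : Measurable g)
    (hh : Measurable h) : Measurable fun x => G (f x) (g x) (h x) :=
  Measurable.comp (g := fun p : SpaceTime × SpaceTime × SpaceTime => G p.1 p.2.1 p.2.2) hG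
    (hf.prodMk (hg.prodMk hh))

theorem tri_mono {G G' : SpaceTime → SpaceTime → SpaceTime → ℝ≥0∞}
    (h : ∀ x y z, x + y + z = 0 → G x y z ≤ G' x y z) : tri G ≤ tri G' :=
  lintegral_mono fun a => lintegral_mono fun b => h _ _ _ (by abel)

theorem tri_eq {G : SpaceTime → SpaceTime → SpaceTime → ℝ≥0∞} (hG : Meas3 G) :
    tri G = ∫⁻ a, ∫⁻ b, G a b (-(a + b)) := by
  rw [lintegral_lintegral_swap
    (by apply Measurable.aemeasurable; exact hG.comp (by fun_prop) (by fun_prop) (by fun_prop))]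
  refine lintegral_congr fun a => ?_
  rw [← lintegral_sub_left_eq_self _ (-a)]
  refine lintegral_congr fun b => ?_
  congr 1 <;> abel

theorem tri_cyc {G : SpaceTime → SpaceTime → SpaceTime → ℝ≥0∞} (hG : Meas3 G) :
    tri (fun x y z => G y z x) = tri G := (tri_eq hG).symm

theorem tri_swap {G : SpaceTime → SpaceTime → SpaceTime → ℝ≥0∞} (hG : Meas3 G) :
    tri (fun x y z => G x z y) = tri G := by
  rw [tri, tri, lintegral_lintegral_swap
    (by apply Measurable.aemeasurable; exact hG.comp (by fun_prop) (by fun_prop) (by fun_prop))]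
  simp only [add_comm]

/-- The trilinear form with kernel `K` is bounded on `L² × L² × L²`. -/
def TriBdd (K : SpaceTime → SpaceTime → SpaceTime → ℝ≥0∞) : Prop :=
  ∃ C : ℝ≥0, ∀ f₀ f₁ f₂ : SpaceTime → ℝ≥0∞, Measurable f₀ → Measurable f₁ → Measurable f₂ →
    tri (fun x y z => K x y z * (f₀ x * f₁ y * f₂ z)) ≤ C * (l2n f₀ * l2n f₁ * l2n f₂)

theorem Meas3.mul_prod {K : SpaceTime → SpaceTime → SpaceTime → ℝ≥0∞} (hK : Meas3 K)
    {f₀ f₁ f₂ : SpaceTime → ℝ≥0∞} (h₀ : Measurable f₀) (h₁ : Measurable f₁) (h₂ : Measurable f₂) :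
    Meas3 fun x y z => K x y z * (f₀ x * f₁ y * f₂ z) := by
  unfold Meas3 at *
  fun_prop

theorem TriBdd.cyc {K : SpaceTime → SpaceTime → SpaceTime → ℝ≥0∞} (h : TriBdd K) (hK : Meas3 K) :
    TriBdd fun x y z => K y z x := by
  obtain ⟨C, hC⟩ := h
  refine ⟨C, fun f₀ f₁ f₂ h₀ h₁ h₂ => ?_⟩
  have := hC f₁ f₂ f₀ h₁ h₂ h₀
  rw [← tri_cyc (hK.mul_prod h₁ h₂ h₀)] at this
  convert this using 1
  · congr! 4; ring
  · ring

theorem TriBdd.swap {K : SpaceTime → SpaceTime → SpaceTime → ℝ≥0∞} (h : TriBdd K) (hK : Meas3 K) :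
    TriBdd fun x y z => K x z y := by
  obtain ⟨C, hC⟩ := h
  refine ⟨C, fun f₀ f₁ f₂ h₀ h₁ h₂ => ?_⟩
  have := hC f₀ f₂ f₁ h₀ h₂ h₁
  rw [← tri_swap (hK.mul_prod h₀ h₂ h₁)] at this
  convert this using 1
  · congr! 4; ring
  · ring

theorem TriBdd.mono {K K' : SpaceTime → SpaceTime → SpaceTime → ℝ≥0∞} (h : TriBdd K') (C : ℝ≥0)
    (hle : ∀ x y z, x + y + z = 0 → K x y z ≤ C * K' x y z) : TriBdd K := by
  obtain ⟨D, hD⟩ := h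
  refine ⟨C * D, fun f₀ f₁ f₂ h₀ h₁ h₂ => ?_⟩
  calc _ ≤ tri (fun x y z => C * (K' x y z * (f₀ x * f₁ y * f₂ z))) := by
        refine tri_mono fun x y z h => ?_
        rw [← mul_assoc (C : ℝ≥0∞)]
        exact mul_le_mul' (hle x y z h) le_rfl
    _ = C * tri (fun x y z => K' x y z * (f₀ x * f₁ y * f₂ z)) := by
        simp only [tri, lintegral_const_mul' _ _ ENNReal.coe_ne_top]
    _ ≤ C * (D * (l2n f₀ * l2n f₁ * l2n f₂)) := by gcongr; exact hD _ _ _ h₀ h₁ h₂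
    _ = _ := by push_cast; ring

theorem TriBdd.add {K K' : SpaceTime → SpaceTime → SpaceTime → ℝ≥0∞} (h : TriBdd K)
    (h' : TriBdd K') (hK : Meas3 K) : TriBdd fun x y z => K x y z + K' x y z := by
  obtain ⟨C, hC⟩ := h
  obtain ⟨D, hD⟩ := h'
  refine ⟨C + D, fun f₀ f₁ f₂ h₀ h₁ h₂ => ?_⟩
  have hm := hK.mul_prod h₀ h₁ h₂
  calc _ = tri (fun x y z => K x y z * (f₀ x * f₁ y * f₂ z))
        + tri (fun x y z => K' x y z * (f₀ x * f₁ y * f₂ z)) := by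
        have hm2 : Measurable (Function.uncurry fun a b =>
            K (-(a + b)) a b * (f₀ (-(a + b)) * f₁ a * f₂ b)) :=
          hm.comp (by fun_prop) (by fun_prop) (by fun_prop)
        have hm3 : Measurable fun a => ∫⁻ b, K (-(a + b)) a b * (f₀ (-(a + b)) * f₁ a * f₂ b) :=
          Measurable.lintegral_prod_right' hm2
        have hm4 : ∀ a, Measurable fun b => K (-(a + b)) a b * (f₀ (-(a + b)) * f₁ a * f₂ b) :=
          fun a => hm2.comp (measurable_const.prodMk measurable_id)
        simp only [tri, add_mul]
        rw [← lintegral_add_left hm3]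
        refine lintegral_congr fun a => ?_
        rw [lintegral_add_left (hm4 a)]
    _ ≤ _ := add_le_add (hC _ _ _ h₀ h₁ h₂) (hD _ _ _ h₀ h₁ h₂)
    _ = _ := by push_cast; ring

theorem lintegral_conv_sq {f g : SpaceTime → ℝ≥0∞} (hf : Measurable f) (hg : Measurable g) :
    ∫⁻ x, ∫⁻ a, (f a * g (-(x + a))) ^ 2 = (∫⁻ a, f a ^ 2) * ∫⁻ b, g b ^ 2 := by
  rw [lintegral_lintegral_swap (by apply Measurable.aemeasurable; fun_prop),
    ← lintegral_mul_const _ (by fun_prop)]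
  refine lintegral_congr fun a => ?_
  simp only [mul_pow]
  rw [lintegral_const_mul _ (by fun_prop), ← lintegral_sub_left_eq_self _ (-a)]
  congr 2
  ext x
  congr 2
  abel

/-- Schur test. -/
theorem TriBdd.of_lintegral_sq_le {K : SpaceTime → SpaceTime → SpaceTime → ℝ≥0∞} (hK : Meas3 K)
    {M : ℝ≥0∞} (hM : M ≠ ∞) (h : ∀ x, ∫⁻ a, K x a (-(x + a)) ^ 2 ≤ M) : TriBdd K := by
  have hM' : M ^ (1 / 2 : ℝ) ≠ ∞ := ENNReal.rpow_ne_top_of_nonneg (by norm_num) hM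
  refine ⟨(M ^ (1 / 2 : ℝ)).toNNReal, fun f₀ f₁ f₂ h₀ h₁ h₂ => ?_⟩
  rw [ENNReal.coe_toNNReal hM', tri_eq (hK.mul_prod h₀ h₁ h₂)]
  have hin : ∀ x, ∫⁻ a, K x a (-(x + a)) * (f₀ x * f₁ a * f₂ (-(x + a)))
      ≤ M ^ (1 / 2 : ℝ) * (f₀ x * l2n fun a => f₁ a * f₂ (-(x + a))) := by
    intro x
    have hk : Measurable fun a => K x a (-(x + a)) :=
      hK.comp (by fun_prop) (by fun_prop) (by fun_prop)
    calc _ = f₀ x * ∫⁻ a, K x a (-(x + a)) * (f₁ a * f₂ (-(x + a))) := by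
          have hk' : Measurable fun a => K x a (-(x + a)) * (f₁ a * f₂ (-(x + a))) :=
            hk.mul (by fun_prop)
          rw [← lintegral_const_mul _ hk']
          refine lintegral_congr fun a => ?_
          ring
      _ ≤ f₀ x * (M ^ (1 / 2 : ℝ) * l2n fun a => f₁ a * f₂ (-(x + a))) := by
          gcongr
          refine (lintegral_mul_le_l2n hk (by fun_prop)).trans ?_
          gcongr
          exact ENNReal.rpow_le_rpow (h x) (by norm_num)
      _ = _ := by ring
  have hm : Measurable fun x => l2n fun a => f₁ a * f₂ (-(x + a)) := by
    unfold l2n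
    fun_prop
  calc _ ≤ ∫⁻ x, M ^ (1 / 2 : ℝ) * (f₀ x * l2n fun a => f₁ a * f₂ (-(x + a))) := lintegral_mono hin
    _ ≤ M ^ (1 / 2 : ℝ) * (l2n f₀ * l2n fun x => l2n fun a => f₁ a * f₂ (-(x + a))) := by
        rw [lintegral_const_mul _ (by fun_prop)]
        gcongr
        exact lintegral_mul_le_l2n h₀ hm
    _ = _ := by
        have : (l2n fun x => l2n fun a => f₁ a * f₂ (-(x + a))) = l2n f₁ * l2n f₂ := by
          rw [l2n]
          simp only [l2n_sq]
          rw [lintegral_conv_sq h₁ h₂, ENNReal.mul_rpow_of_nonneg _ _ (by norm_num)]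
          rfl
        rw [this]; ring

theorem lintegral_conv_reflect {f g : SpaceTime → ℝ≥0∞} (hf : Measurable f) (hg : Measurable g) :
    ∫⁻ x, (∫⁻ a, f a * g (-(x + a))) ^ 2 = ∫⁻ x, (∫⁻ a, f a * g (a - x)) ^ 2 := by
  have e1 : ∀ u : SpaceTime → ℝ≥0∞, Measurable u →
      (∫⁻ a, u a) ^ 2 = ∫⁻ a, ∫⁻ b, u a * u b := by
    intro u hu
    simp only [lintegral_const_mul _ hu]
    rw [lintegral_mul_const _ hu, sq]
  have e2 : ∀ F : SpaceTime → SpaceTime → SpaceTime → ℝ≥0∞, Meas3 F →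
      ∫⁻ x, ∫⁻ a, ∫⁻ b, F x a b = ∫⁻ a, ∫⁻ b, ∫⁻ x, F x a b := by
    intro F hF
    rw [lintegral_lintegral_swap]
    · refine lintegral_congr fun a => ?_
      rw [lintegral_lintegral_swap]
      exact (hF.comp (by fun_prop) (by fun_prop) (by fun_prop)).aemeasurable
    · refine Measurable.aemeasurable (Measurable.lintegral_prod_right'
        (f := fun p : (SpaceTime × SpaceTime) × SpaceTime => F p.1.1 p.1.2 p.2) ?_)
      exact hF.comp (by fun_prop) (by fun_prop) (by fun_prop)
  have m1 : ∀ x, Measurable fun a => f a * g (-(x + a)) := fun x => by fun_prop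
  have m2 : ∀ x, Measurable fun a => f a * g (a - x) := fun x => by fun_prop
  simp only [e1 _ (m1 _), e1 _ (m2 _)]
  rw [e2 (fun x a b => f a * g (-(x + a)) * (f b * g (-(x + b)))) (by unfold Meas3; fun_prop),
    e2 (fun x a b => f a * g (a - x) * (f b * g (b - x))) (by unfold Meas3; fun_prop)]
  refine lintegral_congr fun a => lintegral_congr fun b => ?_
  rw [← lintegral_sub_right_eq_self _ (a + b)]
  refine lintegral_congr fun x => ?_
  have h1 : -(x - (a + b) + a) = b - x := by abel
  have h2 : -(x - (a + b) + b) = a - x := by abel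
  rw [h1, h2]
  ring

theorem lintegral_conv_le_of_reflected {k₁ k₂ f₁ f₂ : SpaceTime → ℝ≥0∞} (hk₁ : Measurable k₁)
    (hk₂ : Measurable k₂) (h₁ : Measurable f₁) (h₂ : Measurable f₂) {M : ℝ≥0∞}
    (h : ∀ x, ∫⁻ a, (k₁ a * k₂ (a - x)) ^ 2 ≤ M) :
    ∫⁻ x, (∫⁻ a, k₁ a * f₁ a * (k₂ (-(x + a)) * f₂ (-(x + a)))) ^ 2
      ≤ M * ((∫⁻ a, f₁ a ^ 2) * ∫⁻ b, f₂ b ^ 2) := by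
  rw [lintegral_conv_reflect (f := fun a => k₁ a * f₁ a) (g := fun a => k₂ a * f₂ a)
    (by fun_prop) (by fun_prop)]
  have hin : ∀ x, (∫⁻ a, k₁ a * f₁ a * (k₂ (a - x) * f₂ (a - x))) ^ 2
      ≤ M * ∫⁻ a, (f₁ a * f₂ (a - x)) ^ 2 := by
    intro x
    calc _ = (∫⁻ a, k₁ a * k₂ (a - x) * (f₁ a * f₂ (a - x))) ^ 2 := by
          congr 2; ext a; ring
      _ ≤ (l2n (fun a => k₁ a * k₂ (a - x)) * l2n fun a => f₁ a * f₂ (a - x)) ^ 2 := by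
          gcongr
          exact lintegral_mul_le_l2n (by fun_prop) (by fun_prop)
      _ ≤ _ := by
          rw [mul_pow, l2n_sq, l2n_sq]
          gcongr
          exact h x
  calc _ ≤ ∫⁻ x, M * ∫⁻ a, (f₁ a * f₂ (a - x)) ^ 2 := lintegral_mono hin
    _ = M * ∫⁻ x, ∫⁻ a, (f₁ a * f₂ (a - x)) ^ 2 := lintegral_const_mul _ (by fun_prop)
    _ = _ := by
        congr 1
        rw [lintegral_lintegral_swap (by apply Measurable.aemeasurable; fun_prop),
          ← lintegral_mul_const _ (by fun_prop)]
        refine lintegral_congr fun a => ?_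
        simp only [mul_pow]
        rw [lintegral_const_mul _ (by fun_prop), lintegral_sub_left_eq_self (fun b => f₂ b ^ 2)]

theorem ofReal_mul_japPow_le {ρ : ℝ} (hρ : 0 ≤ ρ) (p : ℝ) :
    ENNReal.ofReal ρ * japPow (p + 1) ρ ≤ japPow p ρ := by
  have hj := jap_pos ρ
  have hle : ρ ≤ jap ρ := by
    rw [jap]
    exact Real.le_sqrt_of_sq_le (by linarith)
  rw [japPow, japPow, ← ENNReal.ofReal_mul hρ]
  refine ENNReal.ofReal_le_ofReal ?_
  calc ρ * jap ρ ^ (-(p + 1)) ≤ jap ρ * jap ρ ^ (-(p + 1)) := by gcongr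
    _ = jap ρ ^ (-p) := by
        nth_rewrite 1 [← Real.rpow_one (jap ρ)]
        rw [← Real.rpow_add hj]
        congr 1
        ring

/-- The kernel of the trilinear form in the case that the frequency of `x` dominates. -/
def kerHigh (s t η : ℝ) (x y z : SpaceTime) : ℝ≥0∞ :=
  if ‖spt y‖ ≤ 17 * ‖spt x‖ ∧ ‖spt z‖ ≤ 17 * ‖spt x‖ then
    japPow (1 + η) (min ‖spt y‖ ‖spt z‖) * (japPow (1 / 2 + η) (modu s y) *
      japPow (1 / 2 + η) (modu t z))
  else 0

theorem meas3_kerHigh (s t η : ℝ) : Meas3 (kerHigh s t η) := by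
  unfold Meas3 kerHigh
  refine Measurable.ite ?_ (by fun_prop) (by fun_prop)
  exact MeasurableSet.inter
    (measurableSet_le (f := fun p : SpaceTime × SpaceTime × SpaceTime => ‖spt p.2.1‖)
      (g := fun p => 17 * ‖spt p.1‖) (by fun_prop) (by fun_prop))
    (measurableSet_le (f := fun p : SpaceTime × SpaceTime × SpaceTime => ‖spt p.2.2‖)
      (g := fun p => 17 * ‖spt p.1‖) (by fun_prop) (by fun_prop))

theorem triBdd_kerHigh_left {s t η : ℝ} (ht : |t| = 1) (hη : 0 < η) :
    TriBdd fun x y z => (if ‖spt z‖ ≤ 17 * ‖spt x‖ then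
      japPow (1 + η) ‖spt y‖ * (japPow (1 / 2 + η) (modu s y) * japPow (1 / 2 + η) (modu t z))
      else 0) := by
  set q := japPow (1 + 2 * η) with hq
  have hq1 : ∫⁻ x, q x < ∞ := lintegral_japPow_lt_top (by linarith)
  have hw1 : ∫⁻ ρ in Set.Ioi (0 : ℝ), ENNReal.ofReal ρ * japPow (2 + 2 * η) ρ < ∞ := by
    refine lt_of_le_of_lt ?_ hq1
    refine (setLIntegral_mono (measurable_japPow _) fun ρ hρ => ?_).trans
      (setLIntegral_le_lintegral _ _)
    have := ofReal_mul_japPow_le (le_of_lt hρ) (1 + 2 * η)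
    rwa [show 1 + 2 * η + 1 = 2 + 2 * η by ring] at this
  refine TriBdd.of_lintegral_sq_le (M := ENNReal.ofReal (2 * Real.pi * 17) *
      ((∫⁻ x, q x) ^ 2 * ∫⁻ ρ in Set.Ioi (0 : ℝ), ENNReal.ofReal ρ * japPow (2 + 2 * η) ρ)) ?_ ?_ ?_
  · refine Measurable.ite (measurableSet_le (by fun_prop) (by fun_prop)) (by fun_prop) (by fun_prop)
  · exact ENNReal.mul_ne_top ENNReal.ofReal_ne_top
      (ENNReal.mul_ne_top (ENNReal.pow_ne_top hq1.ne) hw1.ne)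
  · intro x
    have hn : spt (-x) = -spt x := rfl
    have := lintegral_two_cones_le (s := s) (s' := -t) (by rwa [abs_neg]) (measurable_japPow _)
      (measurable_japPow (2 + 2 * η)) (A := 17) (-x) (q := q) (K := fun a =>
      (if ‖spt (-(x + a))‖ ≤ 17 * ‖spt x‖ then japPow (1 + η) ‖spt a‖ *
        (japPow (1 / 2 + η) (modu s a) * japPow (1 / 2 + η) (modu t (-(x + a)))) else 0) ^ 2) ?_
    · exact this
    · intro a ha
      have he : a - -x = -(-(x + a)) := by abel
      by_cases hc : ‖spt (-(x + a))‖ ≤ 17 * ‖spt x‖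
      · rw [he, spt_neg, spt_neg x, norm_neg, norm_neg, if_pos hc]
        refine ⟨hc, le_of_eq ?_⟩
        rw [mul_pow, mul_pow, japPow_sq, japPow_sq, japPow_sq, hq]
        have e1 : japPow (1 + 2 * η) (modu (-t) (-(-(x + a))))
            = japPow (1 + 2 * η) (modu t (-(x + a))) := by
          rw [japPow, jap_modu_neg, neg_neg]; rfl
        rw [e1]
        ring_nf
      · simp only [if_neg hc] at ha
        simp at ha

theorem triBdd_kerHigh {s t η : ℝ} (hs : |s| = 1) (ht : |t| = 1) (hη : 0 < η) :
    TriBdd (kerHigh s t η) := by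
  have hm : ∀ s t : ℝ, Meas3 fun x y z => (if ‖spt z‖ ≤ 17 * ‖spt x‖ then
      japPow (1 + η) ‖spt y‖ * (japPow (1 / 2 + η) (modu s y) * japPow (1 / 2 + η) (modu t z))
      else 0) := fun s t =>
    Measurable.ite (measurableSet_le (by fun_prop) (by fun_prop)) (by fun_prop) (by fun_prop)
  have h1 := triBdd_kerHigh_left (s := s) ht hη
  have h2 := (triBdd_kerHigh_left (s := t) hs hη).swap (hm t s)
  refine (h1.add h2 (hm s t)).mono 1 fun x y z _ => ?_
  rw [kerHigh, ENNReal.coe_one, one_mul]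
  split_ifs with h h' h'' h'
  · rcases min_choice ‖spt y‖ ‖spt z‖ with e | e
    · rw [e]; exact le_self_add
    · rw [e, mul_comm (japPow _ (modu s y))]; exact le_add_self
  all_goals first | exact zero_le | exact absurd h.1 ‹_› | exact absurd h.2 ‹_›

/-- The cut-off to the spatial frequencies at distance at most `S` from `v`. -/
def cutBall (S : ℝ) (v : Space) (ζ : SpaceTime) : ℝ≥0∞ :=
  if ‖spt ζ - v‖ ≤ S then 1 else 0

theorem measurable_cutBall_comp {α : Type*} [MeasurableSpace α] {f : α → Space} {g : α → SpaceTime}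
    (hf : Measurable f) (hg : Measurable g) (S : ℝ) : Measurable fun x => cutBall S (f x) (g x) :=
  Measurable.ite (measurableSet_le (by fun_prop) (by fun_prop)) (by fun_prop) (by fun_prop)

theorem cutBall_sq (S : ℝ) (v : Space) (ζ : SpaceTime) : cutBall S v ζ ^ 2 = cutBall S v ζ := by
  unfold cutBall
  split_ifs <;> simp

theorem lintegral_cutBall (S : ℝ) (ζ : SpaceTime) :
    ∫⁻ v, cutBall S v ζ = volume (Metric.closedBall (0 : Space) S) := by
  rw [← Measure.addHaar_closedBall_center (volume : Measure Space) (spt ζ) S,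
    ← lintegral_indicator_one Metric.isClosed_closedBall.measurableSet]
  refine lintegral_congr fun v => ?_
  simp [cutBall, Set.indicator, dist_eq_norm, norm_sub_rev]

theorem lintegral_sq_cutBall_mul (S : ℝ) {f : SpaceTime → ℝ≥0∞} (hf : Measurable f) (e : Space → Space)
    (he : MeasurePreserving e) :
    ∫⁻ v, ∫⁻ ζ, (cutBall S (e v) ζ * f ζ) ^ 2
      = volume (Metric.closedBall (0 : Space) S) * ∫⁻ ζ, f ζ ^ 2 := by
  have hm : ∀ ζ, Measurable fun v => cutBall S (e v) ζ := fun ζ =>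
measurable_cutBall_comp he.measurable measurable_const S
  have hm' : Measurable fun p : Space × SpaceTime => cutBall S (e p.1) p.2 :=
    measurable_cutBall_comp (he.measurable.comp measurable_fst) measurable_snd S
  rw [lintegral_lintegral_swap (by
    apply Measurable.aemeasurable
    exact (hm'.mul (by fun_prop)).pow_const 2), ← lintegral_const_mul _ (by fun_prop)]
  refine lintegral_congr fun ζ => ?_
  simp only [mul_pow, cutBall_sq]
  rw [lintegral_mul_const _ (hm ζ), he.lintegral_comp (f := fun v => cutBall S v ζ)
    (measurable_cutBall_comp measurable_id measurable_const S), lintegral_cutBall]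

theorem lintegral_Ioi_annulus_le (c S : ℝ) :
    ∫⁻ ρ in Set.Ioi (0 : ℝ), ENNReal.ofReal ρ *
      ((Metric.closedBall c S).indicator (japPow 1) ρ) ≤ ENNReal.ofReal (2 * S) := by
  calc _ ≤ ∫⁻ ρ in Set.Ioi (0 : ℝ), (Metric.closedBall c S).indicator 1 ρ := by
        refine setLIntegral_mono (measurable_one.indicator
          Metric.isClosed_closedBall.measurableSet) fun ρ hρ => ?_
        by_cases h : ρ ∈ Metric.closedBall c S
        · have := ofReal_mul_japPow_le (le_of_lt hρ) 0
          simp only [Set.indicator_of_mem h]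
          simpa [japPow] using this
        · simp [Set.indicator_of_notMem h]
    _ ≤ ∫⁻ ρ, (Metric.closedBall c S).indicator 1 ρ := setLIntegral_le_lintegral _ _
    _ = _ := by
        rw [lintegral_indicator_one Metric.isClosed_closedBall.measurableSet, Real.volume_closedBall]

/-- Two input frequencies localized to opposite balls far away from the origin. -/
theorem lintegral_localized_cones_le {s t η S : ℝ} (ht : |t| = 1) (v : Space) (x : SpaceTime) :
    ∫⁻ a, (cutBall S v a * (if 8 * S ≤ ‖spt a‖ then japPow (1 / 2) ‖spt a‖ else 0) *
        japPow (1 / 2 + η) (modu s a) *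
        (cutBall (2 * S) (-v) (a - x) * japPow (1 / 2 + η) (modu t (a - x)))) ^ 2
      ≤ ENNReal.ofReal (2 * Real.pi) * (∫⁻ x, japPow (1 + 2 * η) x) ^ 2 * ENNReal.ofReal (2 * S) := by
  have := lintegral_two_cones_le (s := s) (s' := t) ht (measurable_japPow (1 + 2 * η))
    (w := (Metric.closedBall ‖v‖ S).indicator (japPow 1))
    ((measurable_japPow 1).indicator Metric.isClosed_closedBall.measurableSet) (A := 1) x
    (K := fun a => (cutBall S v a * (if 8 * S ≤ ‖spt a‖ then japPow (1 / 2) ‖spt a‖ else 0) *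
        japPow (1 / 2 + η) (modu s a) *
        (cutBall (2 * S) (-v) (a - x) * japPow (1 / 2 + η) (modu t (a - x)))) ^ 2) ?_
  · refine this.trans ?_
    rw [mul_one, mul_assoc]
    gcongr
    exact lintegral_Ioi_annulus_le _ _
  · intro a ha
    unfold cutBall at ha ⊢
    split_ifs at ha ⊢ with h1 h2 h3 <;> try simp at ha
    have e1 : spt (a - x) = spt a - spt x := rfl
    rw [e1, sub_neg_eq_add] at h3
    rw [e1]
    have hv : 8 * S ≤ ‖v‖ + S := by
      have := norm_add_le (spt a - v) v
      rw [sub_add_cancel] at this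
      linarith
    have hx : 2 * ‖v‖ ≤ ‖spt x‖ + 3 * S := by
      have e2 : (2 : ℝ) • v = spt x - (spt a - v) + (spt a - spt x + v) := by
        rw [two_smul]; abel
      have e3 : ‖(2 : ℝ) • v‖ = 2 * ‖v‖ := by rw [norm_smul]; simp
      have := norm_add_le (spt x - (spt a - v)) (spt a - spt x + v)
      have := norm_sub_le (spt x) (spt a - v)
      rw [← e2] at *
      linarith
    have hax : ‖spt a - spt x‖ ≤ ‖v‖ + 2 * S := by
      have := norm_sub_le (spt a - spt x + v) v
      rw [add_sub_cancel_right] at this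
      linarith
    have hS : 0 ≤ S := (norm_nonneg _).trans h1
    refine ⟨by linarith, ?_⟩
    rw [Set.indicator_of_mem]
    · simp only [one_mul, mul_pow, japPow_sq]
      rw [mul_assoc]
      ring_nf
      exact le_rfl
    · rw [Metric.mem_closedBall, Real.dist_eq]
      exact (abs_norm_sub_norm_le _ _).trans h1

theorem cutBall_le_of_add_eq_zero {S : ℝ} {v : Space} {x y z : SpaceTime} (h : x + y + z = 0) :
    cutBall S 0 x * cutBall S v y ≤ cutBall S v y * cutBall S v y * (cutBall (2 * S) (-v) z *
      cutBall (2 * S) (-v) z) := by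
  unfold cutBall
  split_ifs with h1 h2 h3 <;> simp
  apply h3
  have e : spt z - -v = -(spt x - 0) - (spt y - v) := by
    rw [eq_neg_of_add_eq_zero_right h, spt_neg, spt_add]
    abel
  rw [e]
  refine (norm_sub_le _ _).trans ?_
  rw [norm_neg]
  linarith

theorem measurable_slice {α β : Type*} [MeasurableSpace α] [MeasurableSpace β] {k : α → β → ℝ≥0∞}
    (h : Measurable fun p : α × β => k p.1 p.2) (v : α) : Measurable (k v) :=
  h.comp measurable_prodMk_left

set_option maxHeartbeats 400000 in
theorem tri_localized_le {s t η S : ℝ} (ht : |t| = 1) (hS : 0 < S)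
    {f₀ f₁ f₂ : SpaceTime → ℝ≥0∞} (h₀ : Measurable f₀) (h₁ : Measurable f₁) (h₂ : Measurable f₂) :
    tri (fun x y z => cutBall S 0 x * ((if 8 * S ≤ ‖spt y‖ then japPow (1 / 2) ‖spt y‖ else 0) *
        (japPow (1 / 2 + η) (modu s y) * japPow (1 / 2 + η) (modu t z))) * (f₀ x * f₁ y * f₂ z))
      ≤ (ENNReal.ofReal (2 * Real.pi) * (∫⁻ x, japPow (1 + 2 * η) x) ^ 2 * 16) ^ (1 / 2 : ℝ) *
        ENNReal.ofReal S ^ (1 / 2 : ℝ) * (l2n f₀ * l2n f₁ * l2n f₂) := by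
  set I := (∫⁻ x, japPow (1 + 2 * η) x) with hI
  set M := ENNReal.ofReal (2 * Real.pi) * I ^ 2 * ENNReal.ofReal (2 * S) with hM
  set V := volume (Metric.closedBall (0 : Space) S) with hV
  have hV0 : V ≠ 0 := (Metric.measure_closedBall_pos _ _ hS).ne'
  have hVt : V ≠ ∞ := measure_closedBall_lt_top.ne
  have hV2 : volume (Metric.closedBall (0 : Space) (2 * S)) = 8 * V := by
    rw [hV, Measure.addHaar_closedBall _ _ hS.le, Measure.addHaar_closedBall _ _ (by positivity)]
    rw [← mul_assoc]
    congr 1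
    rw [finrank_euclideanSpace_fin, mul_pow, ENNReal.ofReal_mul (by norm_num)]
    norm_num
  set k : SpaceTime → ℝ≥0∞ := fun y => (if 8 * S ≤ ‖spt y‖ then japPow (1 / 2) ‖spt y‖ else 0) with hk
  have hkm : Measurable k :=
    Measurable.ite (measurableSet_le (by fun_prop) (by fun_prop)) (by fun_prop) (by fun_prop)
  set k₁ : Space → SpaceTime → ℝ≥0∞ := fun v y => cutBall S v y * k y *
    japPow (1 / 2 + η) (modu s y) with hk₁
  set k₂ : Space → SpaceTime → ℝ≥0∞ := fun v z => cutBall (2 * S) (-v) z *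
    japPow (1 / 2 + η) (modu t z) with hk₂
  set g₁ : Space → SpaceTime → ℝ≥0∞ := fun v y => cutBall S v y * f₁ y with hg₁
  set g₂ : Space → SpaceTime → ℝ≥0∞ := fun v z => cutBall (2 * S) (-v) z * f₂ z with hg₂
  have mk₁ : Measurable fun p : Space × SpaceTime => k₁ p.1 p.2 :=
    ((measurable_cutBall_comp measurable_fst measurable_snd S).mul (by fun_prop)).mul (by fun_prop)
  have mk₂ : Measurable fun p : Space × SpaceTime => k₂ p.1 p.2 :=
    (measurable_cutBall_comp measurable_fst.neg measurable_snd _).mul (by fun_prop)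
  have mg₁ : Measurable fun p : Space × SpaceTime => g₁ p.1 p.2 :=
    (measurable_cutBall_comp measurable_fst measurable_snd S).mul (by fun_prop)
  have mg₂ : Measurable fun p : Space × SpaceTime => g₂ p.1 p.2 :=
    (measurable_cutBall_comp measurable_fst.neg measurable_snd _).mul (by fun_prop)
  have mk₁' : ∀ v, Measurable (k₁ v) := measurable_slice mk₁
  have mk₂' : ∀ v, Measurable (k₂ v) := measurable_slice mk₂
  have mg₁' : ∀ v, Measurable (g₁ v) := measurable_slice mg₁
  have mg₂' : ∀ v, Measurable (g₂ v) := measurable_slice mg₂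
  set P : Space → SpaceTime → SpaceTime → SpaceTime → ℝ≥0∞ := fun v x y z =>
    f₀ x * (k₁ v y * g₁ v y * (k₂ v z * g₂ v z)) with hP
  have mP : Measurable fun p : Space × SpaceTime × SpaceTime × SpaceTime =>
      P p.1 p.2.1 p.2.2.1 p.2.2.2 := by
    refine (h₀.comp (by fun_prop)).mul (Measurable.mul (Measurable.mul ?_ ?_) (Measurable.mul ?_ ?_))
    · exact mk₁.comp (f := fun p : Space × SpaceTime × SpaceTime × SpaceTime => (p.1, p.2.2.1))
        (by fun_prop)
    · exact mg₁.comp (f := fun p : Space × SpaceTime × SpaceTime × SpaceTime => (p.1, p.2.2.1))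
        (by fun_prop)
    · exact mk₂.comp (f := fun p : Space × SpaceTime × SpaceTime × SpaceTime => (p.1, p.2.2.2))
        (by fun_prop)
    · exact mg₂.comp (f := fun p : Space × SpaceTime × SpaceTime × SpaceTime => (p.1, p.2.2.2))
        (by fun_prop)
  have mPc : ∀ {α : Type} [MeasurableSpace α] {e : α → Space} {f g h : α → SpaceTime},
      Measurable e → Measurable f → Measurable g → Measurable h →
      Measurable fun x => P (e x) (f x) (g x) (h x) := fun he hf hg hh =>
    mP.comp (he.prodMk (hf.prodMk (hg.prodMk hh)))
  have piece : ∀ v, tri (P v) ≤ l2n f₀ * (M ^ (1 / 2 : ℝ) * (l2n (g₁ v) * l2n (g₂ v))) := by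
    intro v
    rw [tri_eq (mPc measurable_const measurable_fst (measurable_fst.comp measurable_snd)
      (measurable_snd.comp measurable_snd))]
    have mm : Measurable fun p : SpaceTime × SpaceTime =>
        k₁ v p.2 * g₁ v p.2 * (k₂ v (-(p.1 + p.2)) * g₂ v (-(p.1 + p.2))) := by
      have := mk₁' v; have := mk₂' v; have := mg₁' v; have := mg₂' v
      fun_prop
    have mm' : Measurable fun x => ∫⁻ a, k₁ v a * g₁ v a * (k₂ v (-(x + a)) * g₂ v (-(x + a))) :=
      mm.lintegral_prod_right'
    calc _ = ∫⁻ x, f₀ x * ∫⁻ a, k₁ v a * g₁ v a * (k₂ v (-(x + a)) * g₂ v (-(x + a))) := by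
          refine lintegral_congr fun x => ?_
          exact lintegral_const_mul _ (measurable_slice
            (k := fun x a => k₁ v a * g₁ v a * (k₂ v (-(x + a)) * g₂ v (-(x + a)))) mm x)
      _ ≤ l2n f₀ * l2n fun x => ∫⁻ a, k₁ v a * g₁ v a * (k₂ v (-(x + a)) * g₂ v (-(x + a))) :=
          lintegral_mul_le_l2n h₀ mm'
      _ ≤ _ := by
          refine mul_le_mul_right ?_ _
          rw [l2n, l2n, l2n, ← ENNReal.mul_rpow_of_nonneg _ _ (by norm_num),
            ← ENNReal.mul_rpow_of_nonneg _ _ (by norm_num)]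
          refine ENNReal.rpow_le_rpow ?_ (by norm_num)
          exact lintegral_conv_le_of_reflected (mk₁' v) (mk₂' v) (mg₁' v) (mg₂' v)
            fun x => lintegral_localized_cones_le ht v x
  have swap : ∫⁻ v, tri (P v) = tri fun x y z => ∫⁻ v, P v x y z := by
    unfold tri
    rw [lintegral_lintegral_swap]
    · refine lintegral_congr fun a => ?_
      rw [lintegral_lintegral_swap]
      exact (mPc measurable_fst (by fun_prop) measurable_const measurable_snd).aemeasurable
    · refine Measurable.aemeasurable (Measurable.lintegral_prod_right'
        (f := fun p : (Space × SpaceTime) × SpaceTime => P p.1.1 (-(p.1.2 + p.2)) p.1.2 p.2) ?_)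
      exact mPc (by fun_prop) (by fun_prop) (by fun_prop) (by fun_prop)
  have lower : V * tri (fun x y z => cutBall S 0 x * (k y *
        (japPow (1 / 2 + η) (modu s y) * japPow (1 / 2 + η) (modu t z))) * (f₀ x * f₁ y * f₂ z))
      ≤ ∫⁻ v, tri (P v) := by
    have hmul : ∀ G : SpaceTime → SpaceTime → SpaceTime → ℝ≥0∞,
        V * tri G = tri fun x y z => V * G x y z := by
      intro G
      simp only [tri]
      rw [← lintegral_const_mul' _ _ hVt]
      simp only [lintegral_const_mul' _ _ hVt]
    rw [swap, hmul]
    refine tri_mono fun x y z h => ?_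
    have mc : Measurable fun v => cutBall S v y :=
      measurable_cutBall_comp measurable_id measurable_const S
    rw [hV, ← lintegral_cutBall S y, ← lintegral_mul_const _ mc]
    refine lintegral_mono fun v => ?_
    calc _ = cutBall S 0 x * cutBall S v y * (k y * (japPow (1 / 2 + η) (modu s y) *
          japPow (1 / 2 + η) (modu t z)) * (f₀ x * f₁ y * f₂ z)) := by ring
      _ ≤ cutBall S v y * cutBall S v y * (cutBall (2 * S) (-v) z *
          cutBall (2 * S) (-v) z) * (k y * (japPow (1 / 2 + η) (modu s y) *
          japPow (1 / 2 + η) (modu t z)) * (f₀ x * f₁ y * f₂ z)) :=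
          mul_le_mul' (cutBall_le_of_add_eq_zero h) le_rfl
      _ = _ := by simp only [hP, hk₁, hk₂, hg₁, hg₂]; ring
  have sum : ∫⁻ v, l2n (g₁ v) * l2n (g₂ v) ≤ V * 8 ^ (1 / 2 : ℝ) * (l2n f₁ * l2n f₂) := by
    have m1 : Measurable fun v => l2n (g₁ v) :=
      (Measurable.lintegral_prod_right' (mg₁.pow_const 2)).pow_const _
    have m2 : Measurable fun v => l2n (g₂ v) :=
      (Measurable.lintegral_prod_right' (mg₂.pow_const 2)).pow_const _
    refine (lintegral_mul_le_l2n m1 m2).trans (le_of_eq ?_)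
    rw [l2n, l2n]
    simp only [l2n_sq, hg₁, hg₂]
    rw [lintegral_sq_cutBall_mul S h₁ (fun v => v) (MeasurePreserving.id _),
      lintegral_sq_cutBall_mul (2 * S) h₂ (fun v => -v) (Measure.measurePreserving_neg _), hV2]
    simp only [ENNReal.mul_rpow_of_nonneg _ _ (show (0 : ℝ) ≤ 1 / 2 by norm_num)]
    have e : V ^ (1 / 2 : ℝ) * V ^ (1 / 2 : ℝ) = V := by
      rw [← sq, ← ENNReal.rpow_natCast, ← ENNReal.rpow_mul]; norm_num
    rw [l2n, l2n, ← hV]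
    calc _ = V ^ (1 / 2 : ℝ) * V ^ (1 / 2 : ℝ) * 8 ^ (1 / 2 : ℝ) *
          ((∫⁻ ζ, f₁ ζ ^ 2) ^ (1 / 2 : ℝ) * (∫⁻ ζ, f₂ ζ ^ 2) ^ (1 / 2 : ℝ)) := by ring
      _ = _ := by rw [e]
  have key := calc
    V * tri (fun x y z => cutBall S 0 x * (k y *
        (japPow (1 / 2 + η) (modu s y) * japPow (1 / 2 + η) (modu t z))) * (f₀ x * f₁ y * f₂ z))
      ≤ ∫⁻ v, l2n f₀ * (M ^ (1 / 2 : ℝ) * (l2n (g₁ v) * l2n (g₂ v))) :=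
        lower.trans (lintegral_mono piece)
    _ = l2n f₀ * (M ^ (1 / 2 : ℝ) * ∫⁻ v, l2n (g₁ v) * l2n (g₂ v)) := by
        have m1 : Measurable fun v => l2n (g₁ v) :=
          (Measurable.lintegral_prod_right' (mg₁.pow_const 2)).pow_const _
        have m2 : Measurable fun v => l2n (g₂ v) :=
          (Measurable.lintegral_prod_right' (mg₂.pow_const 2)).pow_const _
        rw [lintegral_const_mul _ (by fun_prop), lintegral_const_mul _ (by fun_prop)]
    _ ≤ l2n f₀ * (M ^ (1 / 2 : ℝ) * (V * 8 ^ (1 / 2 : ℝ) * (l2n f₁ * l2n f₂))) :=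
        mul_le_mul_right (mul_le_mul_right sum _) _
    _ = V * ((M ^ (1 / 2 : ℝ) * 8 ^ (1 / 2 : ℝ)) * (l2n f₀ * l2n f₁ * l2n f₂)) := by ring
  rw [ENNReal.mul_le_mul_iff_right hV0 hVt] at key
  refine key.trans (le_of_eq ?_)
  congr 1
  rw [← ENNReal.mul_rpow_of_nonneg _ _ (by norm_num), ← ENNReal.mul_rpow_of_nonneg _ _ (by norm_num),
    hM, ENNReal.ofReal_mul (show (0 : ℝ) ≤ 2 by norm_num) (q := S),
    show ENNReal.ofReal 2 = 2 by norm_num]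
  congr 1
  ring

/-- The kernel of the trilinear form in the case that the frequency of `x` is small. -/
def kerLow (s t η : ℝ) (x y z : SpaceTime) : ℝ≥0∞ :=
  if 16 * ‖spt x‖ ≤ ‖spt y‖ then
    japPow (1 / 2 + η) ‖spt x‖ * (japPow (1 / 2) ‖spt y‖ * (japPow (1 / 2 + η) (modu s y) *
      japPow (1 / 2 + η) (modu t z)))
  else 0

theorem meas3_kerLow (s t η : ℝ) : Meas3 (kerLow s t η) :=
  Measurable.ite (measurableSet_le (by fun_prop) (by fun_prop)) (by fun_prop) (by fun_prop)

theorem ae_spt_ne_zero : ∀ᵐ x : SpaceTime, spt x ≠ 0 := by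
  have hm : MeasurableSet {x : SpaceTime | spt x = 0} :=
    measurableSet_eq_fun (by fun_prop) measurable_const
  have h : volume {x : SpaceTime | spt x = 0} = 0 := by
    rw [← lintegral_indicator_one hm, lintegral_spaceTime_eq _ (measurable_one.indicator hm)]
    refine (lintegral_congr fun τ => ?_).trans lintegral_zero
    rw [← lintegral_zero (μ := (volume : Measure Space))]
    refine lintegral_congr_ae ?_
    filter_upwards [compl_mem_ae_iff.2 (measure_singleton (0 : Space))] with ξ hξ
    rw [Set.indicator_of_notMem]
    simpa [spt_stpt] using hξ
  exact (measure_eq_zero_iff_ae_notMem.1 h).mono fun x hx => hx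

/-- The size of the dyadic pieces of `kerLow`. -/
def dyadicWt (η : ℝ) (j : ℤ) : ℝ := min 1 ((2 : ℝ) ^ (-(1 / 2 + η) * j)) * (2 : ℝ) ^ ((1 / 2 : ℝ) * (j + 1))

theorem dyadicWt_nonneg (η : ℝ) (j : ℤ) : 0 ≤ dyadicWt η j := by
  unfold dyadicWt; positivity

theorem summable_dyadicWt {η : ℝ} (hη : 0 < η) : Summable (dyadicWt η) := by
  have hg : ∀ c : ℝ, 0 < c → Summable fun n : ℕ => (2 : ℝ) ^ (1 / 2 : ℝ) * (2 : ℝ) ^ (-c * n) := by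
    intro c hc
    refine Summable.mul_left _ ?_
    have : (fun n : ℕ => (2 : ℝ) ^ (-c * n)) = fun n => ((2 : ℝ) ^ (-c)) ^ n := by
      ext n
      rw [Real.rpow_mul (by norm_num), Real.rpow_natCast]
    rw [this]
    refine summable_geometric_of_lt_one (by positivity) ?_
    exact Real.rpow_lt_one_of_one_lt_of_neg (by norm_num) (by linarith)
  refine Summable.of_nat_of_neg ?_ ?_
  · refine Summable.of_nonneg_of_le (fun n => dyadicWt_nonneg _ _) (fun n => ?_) (hg η hη)
    calc dyadicWt η n ≤ (2 : ℝ) ^ (-(1 / 2 + η) * (n : ℤ)) * (2 : ℝ) ^ ((1 / 2 : ℝ) * ((n : ℤ) + 1)) := by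
          unfold dyadicWt
          gcongr
          exact min_le_right _ _
      _ = _ := by
          rw [← Real.rpow_add (by norm_num), ← Real.rpow_add (by norm_num)]
          congr 1
          push_cast
          ring
  · refine Summable.of_nonneg_of_le (fun n => dyadicWt_nonneg _ _) (fun n => ?_)
      (hg (1 / 2) (by norm_num))
    calc dyadicWt η (-n) ≤ 1 * (2 : ℝ) ^ ((1 / 2 : ℝ) * ((-n : ℤ) + 1)) := by
          unfold dyadicWt
          gcongr
          exact min_le_left _ _
      _ = _ := by
          rw [one_mul, ← Real.rpow_add (by norm_num)]
          congr 1
          push_cast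
          ring

theorem japPow_le_of_zpow_le {η x : ℝ} (hη : 0 < η) {j : ℤ} (h : (2 : ℝ) ^ j ≤ x) :
    japPow (1 / 2 + η) x ≤ ENNReal.ofReal (min 1 ((2 : ℝ) ^ (-(1 / 2 + η) * j))) := by
  refine ENNReal.ofReal_le_ofReal (le_min ?_ ?_)
  · exact Real.rpow_le_one_of_one_le_of_nonpos (one_le_jap x) (by linarith)
  · have h0 : (0 : ℝ) < 2 ^ j := by positivity
    have hj : (2 : ℝ) ^ j ≤ jap x := h.trans (Real.le_sqrt_of_sq_le (by linarith))
    calc jap x ^ (-(1 / 2 + η)) ≤ ((2 : ℝ) ^ j) ^ (-(1 / 2 + η)) :=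
          Real.rpow_le_rpow_of_nonpos h0 hj (by linarith)
      _ = _ := by
          rw [← Real.rpow_intCast, ← Real.rpow_mul (by norm_num)]
          congr 1
          ring

theorem kerLow_le_tsum {s t η : ℝ} (hη : 0 < η) {x y z : SpaceTime} (hx : spt x ≠ 0) :
    kerLow s t η x y z ≤ ∑' j : ℤ, ENNReal.ofReal (min 1 ((2 : ℝ) ^ (-(1 / 2 + η) * j))) *
      (cutBall ((2 : ℝ) ^ (j + 1)) 0 x * ((if 8 * (2 : ℝ) ^ (j + 1) ≤ ‖spt y‖ then
        japPow (1 / 2) ‖spt y‖ else 0) * (japPow (1 / 2 + η) (modu s y) *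
          japPow (1 / 2 + η) (modu t z)))) := by
  obtain ⟨j, hj1, hj2⟩ := exists_mem_Ico_zpow (norm_pos_iff.2 hx) (one_lt_two (α := ℝ))
  refine le_trans ?_ (ENNReal.le_tsum j)
  unfold kerLow
  split_ifs with h1 h2
  · have hc : cutBall ((2 : ℝ) ^ (j + 1)) 0 x = 1 := by
      rw [cutBall, if_pos]
      rw [sub_zero]
      exact hj2.le
    rw [hc, one_mul]
    exact mul_le_mul' (japPow_le_of_zpow_le hη hj1) le_rfl
  · exfalso
    apply h2
    rw [zpow_add_one₀ (by norm_num)]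
    linarith
  all_goals exact zero_le

theorem triBdd_kerLow {s t η : ℝ} (ht : |t| = 1) (hη : 0 < η) : TriBdd (kerLow s t η) := by
  set A : ℝ≥0∞ :=
    (ENNReal.ofReal (2 * Real.pi) * (∫⁻ x, japPow (1 + 2 * η) x) ^ 2 * 16) ^ (1 / 2 : ℝ) with hA
  have hAt : A ≠ ∞ := by
    refine ENNReal.rpow_ne_top_of_nonneg (by norm_num) ?_
    refine ENNReal.mul_ne_top (ENNReal.mul_ne_top ENNReal.ofReal_ne_top ?_) (by norm_num)
    exact ENNReal.pow_ne_top (lintegral_japPow_lt_top (by linarith)).ne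
  have hD := (summable_dyadicWt hη).tsum_ofReal_ne_top
  refine ⟨((∑' j, ENNReal.ofReal (dyadicWt η j)) * A).toNNReal, fun f₀ f₁ f₂ h₀ h₁ h₂ => ?_⟩
  rw [ENNReal.coe_toNNReal (ENNReal.mul_ne_top hD hAt)]
  set T : ℤ → SpaceTime → SpaceTime → SpaceTime → ℝ≥0∞ := fun j x y z =>
      (cutBall ((2 : ℝ) ^ (j + 1)) 0 x * ((if 8 * (2 : ℝ) ^ (j + 1) ≤ ‖spt y‖ then
        japPow (1 / 2) ‖spt y‖ else 0) * (japPow (1 / 2 + η) (modu s y) *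
          japPow (1 / 2 + η) (modu t z)))) with hT
  set c : ℤ → ℝ≥0∞ := fun j => ENNReal.ofReal (min 1 ((2 : ℝ) ^ (-(1 / 2 + η) * j))) with hc
  have hTm : ∀ j, Meas3 (T j) := by
    intro j
    refine Measurable.mul (measurable_cutBall_comp measurable_const measurable_fst _)
      (Measurable.mul ?_ (by fun_prop))
    exact Measurable.ite (measurableSet_le (by fun_prop) (by fun_prop)) (by fun_prop) (by fun_prop)
  have hGm : ∀ j, Meas3 fun x y z => c j * (T j x y z * (f₀ x * f₁ y * f₂ z)) := fun j =>
    Measurable.const_mul ((hTm j).mul_prod h₀ h₁ h₂) _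
  calc tri (fun x y z => kerLow s t η x y z * (f₀ x * f₁ y * f₂ z))
      ≤ ∫⁻ x, ∫⁻ a, ∑' j, c j * (T j x a (-(x + a)) * (f₀ x * f₁ a * f₂ (-(x + a)))) := by
        rw [tri_eq ((meas3_kerLow s t η).mul_prod h₀ h₁ h₂)]
        refine lintegral_mono_ae (ae_spt_ne_zero.mono fun x hx => lintegral_mono fun a => ?_)
        dsimp only
        simp only [← mul_assoc (c _)]
        rw [ENNReal.tsum_mul_right]
        exact mul_le_mul' (kerLow_le_tsum hη hx) le_rfl
    _ = ∑' j, tri fun x y z => c j * (T j x y z * (f₀ x * f₁ y * f₂ z)) := by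
        have m1 : ∀ j, Measurable (Function.uncurry fun x a =>
            c j * (T j x a (-(x + a)) * (f₀ x * f₁ a * f₂ (-(x + a))))) := fun j =>
          (hGm j).comp measurable_fst measurable_snd (by fun_prop)
        have m2 : ∀ j x, Measurable fun a =>
            c j * (T j x a (-(x + a)) * (f₀ x * f₁ a * f₂ (-(x + a)))) := fun j x =>
          (hGm j).comp measurable_const measurable_id (by fun_prop)
        have m3 : ∀ j, Measurable fun x => ∫⁻ a,
            c j * (T j x a (-(x + a)) * (f₀ x * f₁ a * f₂ (-(x + a)))) := fun j =>
          (m1 j).lintegral_prod_right'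
        simp only [fun j => tri_eq (hGm j)]
        rw [← lintegral_tsum fun j => (m3 j).aemeasurable]
        exact lintegral_congr fun x => lintegral_tsum fun j => (m2 j x).aemeasurable
    _ = ∑' j, c j * tri fun x y z => T j x y z * (f₀ x * f₁ y * f₂ z) := by
        refine tsum_congr fun j => ?_
        simp only [tri, hc, lintegral_const_mul' _ _ ENNReal.ofReal_ne_top]
    _ ≤ ∑' j, c j * (A * ENNReal.ofReal ((2 : ℝ) ^ (j + 1)) ^ (1 / 2 : ℝ) *
          (l2n f₀ * l2n f₁ * l2n f₂)) := by
        refine ENNReal.tsum_le_tsum fun j => mul_le_mul_right ?_ _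
        exact tri_localized_le ht (by positivity) h₀ h₁ h₂
    _ = _ := by
        rw [← ENNReal.tsum_mul_right, ← ENNReal.tsum_mul_right]
        refine tsum_congr fun j => ?_
        rw [dyadicWt, ENNReal.ofReal_mul (by positivity), ENNReal.ofReal_rpow_of_nonneg
          (by positivity) (by norm_num), ← Real.rpow_intCast, ← Real.rpow_mul (by norm_num)]
        push_cast
        rw [mul_comm (1 / 2 : ℝ)]
        ring

theorem mul_one_sub_cos_angle_le_of_add {E : Type*} [NormedAddCommGroup E] [InnerProductSpace ℝ E]
    (u v : E) : ‖u‖ * ‖v‖ * (1 - Real.cos (InnerProductGeometry.angle u v))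
      ≤ (‖u‖ + ‖v‖) * (‖u‖ + ‖v‖ - ‖u + v‖) := by
  have h1 := InnerProductGeometry.cos_angle_mul_norm_mul_norm u v
  have h2 := norm_add_sq_real u v
  have h3 := norm_add_le u v
  nlinarith [norm_nonneg (u + v), norm_nonneg u, norm_nonneg v]

theorem mul_one_sub_cos_angle_le_of_sub {E : Type*} [NormedAddCommGroup E] [InnerProductSpace ℝ E]
    (u v : E) : ‖u‖ * ‖v‖ * (1 - Real.cos (InnerProductGeometry.angle u v))
      ≤ (‖u‖ + ‖v‖) * (‖u - v‖ - |‖u‖ - ‖v‖|) := by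
  have h1 := InnerProductGeometry.cos_angle_mul_norm_mul_norm u v
  have h2 := norm_sub_sq_real u v
  have h3 := norm_sub_le u v
  have h4 := abs_norm_sub_norm_le u v
  have h5 := sq_abs (‖u‖ - ‖v‖)
  nlinarith [norm_nonneg (u - v), norm_nonneg u, norm_nonneg v, abs_nonneg (‖u‖ - ‖v‖)]

theorem mul_one_sub_cos_angle_le {E : Type*} [NormedAddCommGroup E] [InnerProductSpace ℝ E]
    {s₀ s₁ s₂ : ℝ} (h₀ : |s₀| = 1) (h₁ : |s₁| = 1) (h₂ : |s₂| = 1) (u v : E) :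
    ‖u‖ * ‖v‖ * (1 - Real.cos (InnerProductGeometry.angle (s₁ • u) (s₂ • v)))
      ≤ (‖u‖ + ‖v‖) * |s₀ * ‖u + v‖ + s₁ * ‖u‖ + s₂ * ‖v‖| := by
  have A := mul_one_sub_cos_angle_le_of_add (s₁ • u) (s₂ • v)
  have B := mul_one_sub_cos_angle_le_of_sub (s₁ • u) (s₂ • v)
  have hn := norm_add_le u v
  have hp : 0 ≤ ‖u‖ + ‖v‖ := by positivity
  have e1 : ‖s₁ • u‖ = ‖u‖ := by rw [norm_smul, Real.norm_eq_abs, h₁, one_mul]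
  have e2 : ‖s₂ • v‖ = ‖v‖ := by rw [norm_smul, Real.norm_eq_abs, h₂, one_mul]
  rw [e1, e2] at A B
  rcases eq_or_eq_neg_of_abs_eq h₁ with rfl | rfl <;>
  rcases eq_or_eq_neg_of_abs_eq h₂ with rfl | rfl <;>
  simp only [one_smul, neg_smul, ← sub_eq_add_neg, sub_neg_eq_add, ← neg_add', norm_neg] at A B ⊢
  · refine A.trans (mul_le_mul_of_nonneg_left ?_ hp)
    refine le_trans ?_ (le_abs_self _)
    rcases eq_or_eq_neg_of_abs_eq h₀ with rfl | rfl <;> linarith [norm_nonneg (u + v)]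
  · refine B.trans (mul_le_mul_of_nonneg_left ?_ hp)
    rcases eq_or_eq_neg_of_abs_eq h₀ with rfl | rfl
    · refine le_trans ?_ (le_abs_self _)
      linarith [neg_abs_le (‖u‖ - ‖v‖)]
    · refine le_trans ?_ (neg_le_abs _)
      linarith [le_abs_self (‖u‖ - ‖v‖)]
  · refine B.trans (mul_le_mul_of_nonneg_left ?_ hp)
    rcases eq_or_eq_neg_of_abs_eq h₀ with rfl | rfl
    · refine le_trans ?_ (le_abs_self _)
      linarith [le_abs_self (‖u‖ - ‖v‖)]
    · refine le_trans ?_ (neg_le_abs _)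
      linarith [neg_abs_le (‖u‖ - ‖v‖)]
  · refine A.trans (mul_le_mul_of_nonneg_left ?_ hp)
    refine le_trans ?_ (neg_le_abs _)
    rcases eq_or_eq_neg_of_abs_eq h₀ with rfl | rfl <;> linarith [norm_nonneg (u + v)]

theorem abs_le_jap (x : ℝ) : |x| ≤ jap x := Real.abs_le_sqrt (by linarith)

theorem jap_le_one_add {x : ℝ} (hx : 0 ≤ x) : jap x ≤ 1 + x :=
  Real.sqrt_le_iff.2 ⟨by linarith, by nlinarith⟩

theorem jap_mono {x y : ℝ} (hx : 0 ≤ x) (h : x ≤ y) : jap x ≤ jap y :=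
  Real.sqrt_le_sqrt (by nlinarith)

theorem sq_angle_mul_jap_min_le {s₀ s₁ s₂ L : ℝ} (h₀ : |s₀| = 1) (h₁ : |s₁| = 1) (h₂ : |s₂| = 1)
    {x y z : SpaceTime} (h : x + y + z = 0) (l₀ : jap (modu s₀ x) ≤ L) (l₁ : jap (modu s₁ y) ≤ L)
    (l₂ : jap (modu s₂ z) ≤ L) :
    InnerProductGeometry.angle (s₁ • spt y) (s₂ • spt z) ^ 2 * jap (min ‖spt y‖ ‖spt z‖) ≤ 40 * L := by
  set θ := InnerProductGeometry.angle (s₁ • spt y) (s₂ • spt z) with hθ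
  have hθ0 : 0 ≤ θ := InnerProductGeometry.angle_nonneg _ _
  have hθπ : θ ≤ Real.pi := InnerProductGeometry.angle_le_pi _ _
  have hL : 1 ≤ L := (one_le_jap _).trans l₀
  have hc := Real.cos_le_one_sub_mul_cos_sq (x := θ) (by rwa [abs_of_nonneg hθ0])
  have hm := mul_one_sub_cos_angle_le h₀ h₁ h₂ (spt y) (spt z)
  rw [← hθ] at hm
  have hx : ‖spt y + spt z‖ = ‖spt x‖ := by
    have : x = -(y + z) := by rw [eq_neg_iff_add_eq_zero, ← h]; abel
    rw [this, spt_neg, norm_neg, spt_add]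
  have h0 : x 0 + y 0 + z 0 = 0 := by
    have := congrArg (fun w : SpaceTime => w 0) h
    simpa using this
  have hs : |s₀ * ‖spt y + spt z‖ + s₁ * ‖spt y‖ + s₂ * ‖spt z‖| ≤ 3 * L := by
    have e : s₀ * ‖spt y + spt z‖ + s₁ * ‖spt y‖ + s₂ * ‖spt z‖
        = modu s₀ x + modu s₁ y + modu s₂ z := by
      rw [hx]; simp only [modu]; linarith
    rw [e]
    have a0 := (abs_le_jap (modu s₀ x)).trans l₀
    have a1 := (abs_le_jap (modu s₁ y)).trans l₁
    have a2 := (abs_le_jap (modu s₂ z)).trans l₂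
    have := abs_add_three (modu s₀ x) (modu s₁ y) (modu s₂ z)
    linarith
  set ρ := ‖spt y‖ with hρ
  set σ := ‖spt z‖ with hσ
  have hρ0 : 0 ≤ ρ := norm_nonneg _
  have hσ0 : 0 ≤ σ := norm_nonneg _
  have hmin0 : 0 ≤ min ρ σ := le_min hρ0 hσ0
  have hmain : min ρ σ * (1 - Real.cos θ) ≤ 2 * (3 * L) := by
    have hcos : 0 ≤ 1 - Real.cos θ := by linarith [Real.cos_le_one θ]
    rcases eq_or_lt_of_le (add_nonneg hρ0 hσ0) with h0' | hpos
    · have : min ρ σ = 0 := le_antisymm (by linarith [min_le_left ρ σ]) hmin0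
      rw [this]; linarith
    · have h5 : min ρ σ * (ρ + σ) ≤ 2 * (ρ * σ) := by
        rcases le_total ρ σ with h' | h'
        · rw [min_eq_left h']; nlinarith
        · rw [min_eq_right h']; nlinarith
      have h6 : (ρ + σ) * (min ρ σ * (1 - Real.cos θ)) ≤ (ρ + σ) * (2 * (3 * L)) := by
        have := mul_le_mul_of_nonneg_right h5 hcos
        have := mul_le_mul_of_nonneg_left hs hpos.le
        nlinarith
      exact le_of_mul_le_mul_left h6 hpos
  have hpi : Real.pi ^ 2 ≤ 10 := by nlinarith [Real.pi_lt_d2, Real.pi_pos]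
  have hpi0 : 0 < Real.pi ^ 2 := by positivity
  have hq : min ρ σ * (2 * θ ^ 2) ≤ 6 * L * Real.pi ^ 2 := by
    have h7 : 2 / Real.pi ^ 2 * θ ^ 2 ≤ 1 - Real.cos θ := by linarith
    have h8 := (mul_le_mul_of_nonneg_left h7 hmin0).trans hmain
    have h9 := mul_le_mul_of_nonneg_right h8 hpi0.le
    have e : min ρ σ * (2 / Real.pi ^ 2 * θ ^ 2) * Real.pi ^ 2 = min ρ σ * (2 * θ ^ 2) := by
      field_simp
    rw [e] at h9
    linarith
  have hj := jap_le_one_add hmin0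
  have hθ2 : θ ^ 2 ≤ Real.pi ^ 2 := by gcongr
  nlinarith [mul_le_mul_of_nonneg_left hj (sq_nonneg θ)]

theorem angle_le_exp {s₀ s₁ s₂ l a : ℝ} (h₀ : |s₀| = 1) (h₁ : |s₁| = 1) (h₂ : |s₂| = 1)
    (ha : 0 ≤ a) (ha' : a ≤ 1 / 2)
    {x y z : SpaceTime} (h : x + y + z = 0) (l₀ : Real.log (jap (modu s₀ x)) ≤ l)
    (l₁ : Real.log (jap (modu s₁ y)) ≤ l) (l₂ : Real.log (jap (modu s₂ z)) ≤ l) :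
    InnerProductGeometry.angle (s₁ • spt y) (s₂ • spt z) ≤
      Real.exp (2 + a * (l - Real.log (jap (min ‖spt y‖ ‖spt z‖)))) := by
  have hsq := sq_angle_mul_jap_min_le h₀ h₁ h₂ h (L := Real.exp l)
    ((Real.log_le_iff_le_exp (jap_pos _)).1 l₀) ((Real.log_le_iff_le_exp (jap_pos _)).1 l₁)
    ((Real.log_le_iff_le_exp (jap_pos _)).1 l₂)
  set θ := InnerProductGeometry.angle (s₁ • spt y) (s₂ • spt z) with hθ
  have hθπ : θ ≤ Real.pi := InnerProductGeometry.angle_le_pi _ _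
  have he1 : (2.7 : ℝ) < Real.exp 1 := by linarith [Real.exp_one_gt_d9]
  have he2 : Real.exp 2 = Real.exp 1 ^ 2 := by rw [← Real.exp_nat_mul]; norm_num
  have he4 : Real.exp 4 = Real.exp 2 ^ 2 := by rw [← Real.exp_nat_mul]; norm_num
  have he2' : 7.2 < Real.exp 2 := by rw [he2]; nlinarith
  have he4' : 40 < Real.exp 4 := by rw [he4]; nlinarith
  rcases eq_or_lt_of_le (InnerProductGeometry.angle_nonneg (s₁ • spt y) (s₂ • spt z)) with h0 | h0
  · rw [hθ, ← h0]; positivity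
  · rw [← hθ] at h0
    rw [← Real.log_le_iff_le_exp h0]
    have hj := jap_pos (min ‖spt y‖ ‖spt z‖)
    have b1 : Real.log θ ≤ 2 := (Real.log_le_iff_le_exp h0).2 (by linarith [Real.pi_lt_d2])
    have b2 : 2 * Real.log θ + Real.log (jap (min ‖spt y‖ ‖spt z‖)) ≤ 4 + l := by
      have e : 2 * Real.log θ + Real.log (jap (min ‖spt y‖ ‖spt z‖))
          = Real.log (θ ^ 2 * jap (min ‖spt y‖ ‖spt z‖)) := by
        rw [Real.log_mul (by positivity) hj.ne', Real.log_pow]; norm_num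
      rw [e, Real.log_le_iff_le_exp (by positivity), Real.exp_add]
      refine hsq.trans ?_
      gcongr
    nlinarith

/-- The logarithm of the Japanese bracket. -/
def logJap (x : ℝ) : ℝ := Real.log (jap x)

theorem logJap_nonneg (x : ℝ) : 0 ≤ logJap x := Real.log_nonneg (one_le_jap x)

theorem logJap_mono {x y : ℝ} (hx : 0 ≤ x) (h : x ≤ y) : logJap x ≤ logJap y :=
  Real.log_le_log (jap_pos _) (jap_mono hx h)

theorem logJap_le_add {x y c k : ℝ} (hx : 0 ≤ x) (h : x ≤ c * y) (hc : 1 ≤ c)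
    (hk : c ≤ Real.exp k) : logJap x ≤ k + logJap y := by
  have hy1 : jap (c * y) ≤ c * jap y := by
    have h3 : jap y ^ 2 = 1 + y ^ 2 := Real.sq_sqrt (by positivity)
    have h4 := jap_pos y
    rw [jap, Real.sqrt_le_iff]
    refine ⟨by positivity, ?_⟩
    rw [mul_pow, mul_pow, h3]
    nlinarith
  have h2 : jap x ≤ Real.exp k * jap y :=
    ((jap_mono hx h).trans hy1).trans (mul_le_mul_of_nonneg_right hk (jap_pos y).le)
  have := Real.log_le_log (jap_pos x) h2
  rwa [Real.log_mul (Real.exp_pos _).ne' (jap_pos y).ne', Real.log_exp] at this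

theorem two_le_exp_one : (2 : ℝ) ≤ Real.exp 1 := by linarith [Real.exp_one_gt_d9]

theorem logJap_le_or_of_le_add {x y z : ℝ} (hx : 0 ≤ x)
    (h : x ≤ y + z) : logJap x ≤ 1 + logJap y ∨ logJap x ≤ 1 + logJap z := by
  rcases le_total y z with hc | hc
  · exact Or.inr (logJap_le_add hx (c := 2) (by linarith) one_le_two two_le_exp_one)
  · exact Or.inl (logJap_le_add hx (c := 2) (by linarith) one_le_two two_le_exp_one)

theorem norm_spt_triangle {x y z : SpaceTime} (h : x + y + z = 0) :
    ‖spt x‖ ≤ ‖spt y‖ + ‖spt z‖ ∧ ‖spt y‖ ≤ ‖spt x‖ + ‖spt z‖ ∧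
      ‖spt z‖ ≤ ‖spt x‖ + ‖spt y‖ := by
  have hx : x = -y + -z := by rw [← sub_eq_zero, ← h]; abel
  have hy : y = -x + -z := by rw [← sub_eq_zero, ← h]; abel
  have hz : z = -x + -y := by rw [← sub_eq_zero, ← h]; abel
  refine ⟨?_, ?_, ?_⟩
  · rw [hx, spt_add, spt_neg, spt_neg]
    exact (norm_add_le _ _).trans (by simp)
  · nth_rewrite 1 [hy]
    rw [spt_add, spt_neg, spt_neg]
    exact (norm_add_le _ _).trans (by simp)
  · nth_rewrite 1 [hz]
    rw [spt_add, spt_neg, spt_neg]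
    exact (norm_add_le _ _).trans (by simp)

theorem seventeen_le_exp_three : (17 : ℝ) ≤ Real.exp 3 := by
  have h : Real.exp 3 = Real.exp 1 ^ 3 := by rw [← Real.exp_nat_mul]; norm_num
  have h1 : (2.7 : ℝ) < Real.exp 1 := by linarith [Real.exp_one_gt_d9]
  rw [h]
  calc (17 : ℝ) ≤ 2.7 ^ 3 := by norm_num
    _ ≤ _ := by gcongr

theorem japPow_eq_exp (p x : ℝ) : japPow p x = ENNReal.ofReal (Real.exp (-p * logJap x)) := by
  rw [japPow, Real.rpow_def_of_pos (jap_pos x), mul_comm, logJap]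

/-- The kernel of the trilinear form dual to the null form estimate. -/
def kerNull (s₀ s₁ s₂ l r ε : ℝ) (x y z : SpaceTime) : ℝ≥0∞ :=
  ENNReal.ofReal (InnerProductGeometry.angle (s₁ • spt y) (s₂ • spt z)) *
    (japPow (-r) ‖spt x‖ * japPow l ‖spt y‖ * japPow l ‖spt z‖ *
      (japPow (1 / 2 - 2 * ε) (modu s₀ x) * japPow (3 / 4 + ε) (modu s₁ y) *
        japPow (3 / 4 + ε) (modu s₂ z)))

theorem kerNull_swap (s₀ s₁ s₂ l r ε : ℝ) (x y z : SpaceTime) :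
    kerNull s₀ s₁ s₂ l r ε x y z = kerNull s₀ s₂ s₁ l r ε x z y := by
  unfold kerNull
  rw [InnerProductGeometry.angle_comm]
  ring

theorem kerHigh_swap (s t η : ℝ) (x y z : SpaceTime) :
    kerHigh s t η x y z = kerHigh t s η x z y := by
  unfold kerHigh
  refine if_congr and_comm ?_ rfl
  rw [min_comm, mul_comm (japPow _ (modu s y))]

theorem kerNull_le_exp {s₀ s₁ s₂ l r ε a Λ : ℝ} (h₀ : |s₀| = 1) (h₁ : |s₁| = 1) (h₂ : |s₂| = 1)
    (ha : 0 ≤ a) (ha' : a ≤ 1 / 2) {x y z : SpaceTime} (h : x + y + z = 0)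
    (l₀ : logJap (modu s₀ x) ≤ Λ) (l₁ : logJap (modu s₁ y) ≤ Λ) (l₂ : logJap (modu s₂ z) ≤ Λ) :
    kerNull s₀ s₁ s₂ l r ε x y z ≤ ENNReal.ofReal (Real.exp (
      2 + a * (Λ - logJap (min ‖spt y‖ ‖spt z‖)) + r * logJap ‖spt x‖ - l * logJap ‖spt y‖
      - l * logJap ‖spt z‖ - (1 / 2 - 2 * ε) * logJap (modu s₀ x)
      - (3 / 4 + ε) * logJap (modu s₁ y) - (3 / 4 + ε) * logJap (modu s₂ z))) := by
  rw [kerNull]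
  simp only [japPow_eq_exp]
  refine (mul_le_mul' (ENNReal.ofReal_le_ofReal (angle_le_exp h₀ h₁ h₂ ha ha' h l₀ l₁ l₂))
    le_rfl).trans (le_of_eq ?_)
  simp only [← ENNReal.ofReal_mul (Real.exp_pos _).le, ← Real.exp_add, logJap]
  congr 2
  ring

theorem kerHigh_eq_exp {s t η : ℝ} {x y z : SpaceTime} (hy : ‖spt y‖ ≤ 17 * ‖spt x‖)
    (hz : ‖spt z‖ ≤ 17 * ‖spt x‖) : kerHigh s t η x y z = ENNReal.ofReal (Real.exp (
      -(1 + η) * logJap (min ‖spt y‖ ‖spt z‖) - (1 / 2 + η) * logJap (modu s y)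
      - (1 / 2 + η) * logJap (modu t z))) := by
  rw [kerHigh, if_pos ⟨hy, hz⟩]
  simp only [japPow_eq_exp]
  simp only [← ENNReal.ofReal_mul (Real.exp_pos _).le, ← Real.exp_add]
  congr 2
  ring

theorem kerLow_eq_exp {s t η : ℝ} {x y z : SpaceTime} (hy : 16 * ‖spt x‖ ≤ ‖spt y‖) :
    kerLow s t η x y z = ENNReal.ofReal (Real.exp (
      -(1 / 2 + η) * logJap ‖spt x‖ - 1 / 2 * logJap ‖spt y‖ - (1 / 2 + η) * logJap (modu s y)
      - (1 / 2 + η) * logJap (modu t z))) := by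
  rw [kerLow, if_pos hy]
  simp only [japPow_eq_exp]
  simp only [← ENNReal.ofReal_mul (Real.exp_pos _).le, ← Real.exp_add]
  congr 2
  ring

theorem le_exp_mul_of_le {K K' : ℝ≥0∞} {A B C : ℝ} (h : K ≤ ENNReal.ofReal (Real.exp A))
    (h' : K' = ENNReal.ofReal (Real.exp B)) (hAB : A ≤ C + B) :
    K ≤ ENNReal.ofReal (Real.exp C) * K' := by
  rw [h', ← ENNReal.ofReal_mul (Real.exp_pos _).le, ← Real.exp_add]
  exact h.trans (ENNReal.ofReal_le_ofReal (Real.exp_le_exp.2 hAB))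

/-- The constraints on the exponents under which the kernel bounds hold. -/
structure Admissible (l r ε : ℝ) : Prop where
  pos : 0 < ε
  small : ε ≤ 1 / 20
  low : 1 / 6 ≤ l
  le : r ≤ l
  add_nonneg : 0 ≤ l + r
  two_sub : 1 / 2 + 3 * ε ≤ 2 * l - r
  three_sub : 3 / 4 + ε ≤ 3 * l - 2 * r

section Exponents

variable {l r ε n₀ n₁ n₂ m a b c : ℝ}

theorem exponent_low (H : Admissible l r ε) (h₀ : 0 ≤ n₀) (h₀₁ : n₀ ≤ n₁)
    (h₁₂ : n₁ ≤ n₂ + 1) (hm : n₁ - 1 ≤ m) (hb : 0 ≤ b) (hc : 0 ≤ c) :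
    2 + (1 / 2 - 2 * ε) * (a - m) + r * n₀ - l * n₁ - l * n₂ - (1 / 2 - 2 * ε) * a
      - (3 / 4 + ε) * b - (3 / 4 + ε) * c ≤
    (100 + 100 * l) + (-(1 / 2 + ε) * n₀ - 1 / 2 * n₁ - (1 / 2 + ε) * b - (1 / 2 + ε) * c) := by
  obtain ⟨p1, p2, p3, p4, p5, p6, p7⟩ := H
  have e1 : (1 / 2 - 2 * ε) * (n₁ - 1) ≤ (1 / 2 - 2 * ε) * m :=
    mul_le_mul_of_nonneg_left hm (by linarith)
  have e2 : l * n₁ ≤ l * (n₂ + 1) := mul_le_mul_of_nonneg_left h₁₂ (by linarith)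
  have e3 : (1 / 2 + ε + r) * n₀ ≤ (2 * l - 2 * ε) * n₁ := by
    have : (1 / 2 + ε + r) * n₀ ≤ (2 * l - 2 * ε) * n₀ :=
      mul_le_mul_of_nonneg_right (by linarith) h₀
    exact this.trans (mul_le_mul_of_nonneg_left h₀₁ (by linarith))
  nlinarith

theorem exponent_high (H : Admissible l r ε) (hm₁ : m ≤ n₁) (hm₂ : m ≤ n₂) (hm : 0 ≤ m)
    (hm' : m = n₁ ∨ m = n₂) (h₁₀ : n₁ ≤ 3 + n₀) (h₂₀ : n₂ ≤ 3 + n₀)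
    (h₀ : n₀ ≤ 1 + n₁ ∨ n₀ ≤ 1 + n₂) (hb : 0 ≤ b) (hc : 0 ≤ c) :
    2 + (1 / 2 - 2 * ε) * (a - m) + r * n₀ - l * n₁ - l * n₂ - (1 / 2 - 2 * ε) * a
      - (3 / 4 + ε) * b - (3 / 4 + ε) * c ≤
    (100 + 100 * l) + (-(1 + ε) * m - (1 / 2 + ε) * b - (1 / 2 + ε) * c) := by
  obtain ⟨p1, p2, p3, p4, p5, p6, p7⟩ := H
  obtain ⟨M, hM, hmM, hM1, hM2⟩ : ∃ M, M + m = n₁ + n₂ ∧ m ≤ M ∧ M ≤ 3 + n₀ ∧ n₀ ≤ 1 + M := by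
    rcases hm' with rfl | rfl
    · exact ⟨n₂, by ring, hm₂, h₂₀, by rcases h₀ with h | h <;> linarith⟩
    · exact ⟨n₁, by ring, hm₁, h₁₀, by rcases h₀ with h | h <;> linarith⟩
  have e1 : r * n₀ ≤ r * M + 3 * l := by
    have : |r| ≤ l := abs_le.2 ⟨by linarith, p4⟩
    have h2 : r * (n₀ - M) ≤ |r| * |n₀ - M| := by rw [← abs_mul]; exact le_abs_self _
    have h3 : |n₀ - M| ≤ 3 := abs_le.2 ⟨by linarith, by linarith⟩
    nlinarith [abs_nonneg r, abs_nonneg (n₀ - M)]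
  have e2 : (r - l) * M ≤ (r - l) * m := mul_le_mul_of_nonpos_left hmM (by linarith)
  have e3 : (r - 2 * l + 1 / 2 + 3 * ε) * m ≤ 0 := mul_nonpos_of_nonpos_of_nonneg (by linarith) hm
  have e4 : l * n₁ + l * n₂ = l * M + l * m := by rw [← mul_add, ← hM]; ring
  nlinarith

theorem exponent_mixed (H : Admissible l r ε) (h₁ : 0 ≤ n₁) (h₁₂ : n₁ ≤ n₂) (h₀₂ : n₀ ≤ n₂ + 1)
    (h₂₀ : n₂ ≤ n₀ + 1) (ha : 0 ≤ a) (hb : 0 ≤ b) (hc : 0 ≤ c) :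
    ∃ α : ℝ, 0 ≤ α ∧ α ≤ 1 / 2 ∧
    2 + (1 / 4 + α / 2) * (b - n₁) + r * n₀ - l * n₁ - l * n₂ - (1 / 2 - 2 * ε) * a
      - (3 / 4 + ε) * b - (3 / 4 + ε) * c ≤
    (100 + 100 * l) + max (-(1 / 2 + ε) * n₁ - 1 / 2 * n₂ - (1 / 2 + ε) * c - (1 / 2 + ε) * a)
      (-(1 + ε) * n₁ - (1 / 2 + ε) * b - (1 / 2 + ε) * c) := by
  obtain ⟨p1, p2, p3, p4, p5, p6, p7⟩ := H
  obtain ⟨α, hα0, hα1, hα2, hα3⟩ : ∃ α : ℝ, 0 ≤ α ∧ α ≤ 1 / 2 ∧ α ≤ 2 * (l - r) ∧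
      3 / 4 + ε ≤ l + (l - r) + α / 2 := by
    rcases le_total (2 * (l - r)) (1 / 2) with h | h
    · exact ⟨2 * (l - r), by linarith, h, le_rfl, by linarith⟩
    · exact ⟨1 / 2, by norm_num, le_rfl, h, by linarith⟩
  refine ⟨α, hα0, hα1, ?_⟩
  set A := -(1 / 2 + ε) * n₁ - 1 / 2 * n₂ - (1 / 2 + ε) * c - (1 / 2 + ε) * a with hA
  set B := -(1 + ε) * n₁ - (1 / 2 + ε) * b - (1 / 2 + ε) * c with hB
  have hmax : α * A + (1 - α) * B ≤ max A B := by
    have := mul_le_mul_of_nonneg_left (le_max_left A B) hα0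
    have := mul_le_mul_of_nonneg_left (le_max_right A B) (show 0 ≤ 1 - α by linarith)
    linarith
  have e1 : r * n₀ ≤ r * n₂ + l := by
    have : |r| ≤ l := abs_le.2 ⟨by linarith, p4⟩
    have h2 : r * (n₀ - n₂) ≤ |r| * |n₀ - n₂| := by rw [← abs_mul]; exact le_abs_self _
    have h3 : |n₀ - n₂| ≤ 1 := abs_le.2 ⟨by linarith, by linarith⟩
    nlinarith [abs_nonneg r, abs_nonneg (n₀ - n₂)]
  have e2 : (l - r - α / 2) * n₁ ≤ (l - r - α / 2) * n₂ :=
    mul_le_mul_of_nonneg_left h₁₂ (by linarith)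
  have e3 : (3 / 4 + ε - (l + (l - r) + α / 2)) * n₁ ≤ 0 :=
    mul_nonpos_of_nonpos_of_nonneg (by linarith) h₁
  have e3' : 0 ≤ α * n₁ * ε := by positivity
  have e4 : 0 ≤ (1 / 2 - 2 * ε - α / 2 - α * ε) * a := mul_nonneg (by nlinarith) ha
  have e5 : 0 ≤ α * ε * b := by positivity
  refine le_trans ?_ (add_le_add_right hmax _)
  rw [hA, hB]
  nlinarith

theorem exponent_far (H : Admissible l r ε) {k : ℝ} (h₀ : 0 ≤ n₀) (h₂ : 0 ≤ n₂)
    (h₀₁ : n₀ ≤ 3 + n₁) (h₂₁ : n₂ ≤ 3 + n₁)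
    (hm : n₂ - 3 ≤ m) (hk₀ : k ≤ n₀) (hk₂ : k ≤ n₂) (ha : 0 ≤ a) (hab : a ≤ b) (hc : 0 ≤ c) :
    2 + 1 / 2 * (b - m) + r * n₀ - l * n₁ - l * n₂ - (1 / 2 - 2 * ε) * a
      - (3 / 4 + ε) * b - (3 / 4 + ε) * c ≤
    (100 + 100 * l) + (-(1 + ε) * k - (1 / 2 + ε) * c - (1 / 2 + ε) * a) := by
  obtain ⟨p1, p2, p3, p4, p5, p6, p7⟩ := H
  have e1 : 3 * ε * a ≤ (1 / 4 + ε) * b := by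
    have : 3 * ε * a ≤ (1 / 4 + ε) * a := mul_le_mul_of_nonneg_right (by linarith) ha
    exact this.trans (mul_le_mul_of_nonneg_left hab (by linarith))
  have key : r * n₀ - l * n₁ - l * n₂ - 1 / 2 * n₂ + (1 + ε) * k ≤ 10 + 10 * l := by
    rcases le_total n₂ n₀ with h | h
    · have f1 : n₀ - 3 ≤ n₁ := by linarith
      have f2 : l * (n₀ - 3) ≤ l * n₁ := mul_le_mul_of_nonneg_left f1 (by linarith)
      have f3 : (r - l) * n₀ ≤ (r - l) * n₂ := mul_le_mul_of_nonpos_left h (by linarith)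
      have f4 : (r - 2 * l + 1 / 2 + ε) * n₂ ≤ 0 :=
        mul_nonpos_of_nonpos_of_nonneg (by linarith) h₂
      have f5 : (1 + ε) * k ≤ (1 + ε) * n₂ := mul_le_mul_of_nonneg_left hk₂ (by linarith)
      nlinarith
    · have f1 : n₂ - 3 ≤ n₁ := by linarith
      have f2 : l * (n₂ - 3) ≤ l * n₁ := mul_le_mul_of_nonneg_left f1 (by linarith)
      have f5 : (1 + ε) * k ≤ (1 + ε) * n₀ := mul_le_mul_of_nonneg_left hk₀ (by linarith)
      have f6 : (r + 1 + ε) * n₀ ≤ (2 * l + 1 / 2) * n₂ := by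
        have : (r + 1 + ε) * n₀ ≤ (2 * l + 1 / 2) * n₀ :=
          mul_le_mul_of_nonneg_right (by linarith) h₀
        exact this.trans (mul_le_mul_of_nonneg_left h (by linarith))
      nlinarith
  nlinarith

end Exponents

theorem kerNull_le_of_first {s₀ s₁ s₂ l r ε : ℝ} (h₀ : |s₀| = 1) (h₁ : |s₁| = 1) (h₂ : |s₂| = 1)
    (H : Admissible l r ε) {x y z : SpaceTime} (h : x + y + z = 0)
    (l₁ : logJap (modu s₁ y) ≤ logJap (modu s₀ x)) (l₂ : logJap (modu s₂ z) ≤ logJap (modu s₀ x)) :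
    kerNull s₀ s₁ s₂ l r ε x y z ≤ ENNReal.ofReal (Real.exp (100 + 100 * l)) *
      (kerLow s₁ s₂ ε x y z + kerHigh s₁ s₂ ε x y z) := by
  have hnull := kerNull_le_exp (l := l) (r := r) (ε := ε) (a := 1 / 2 - 2 * ε) h₀ h₁ h₂
    (by linarith [H.small]) (by linarith [H.pos]) h le_rfl l₁ l₂
  obtain ⟨t₀, t₁, t₂⟩ := norm_spt_triangle h
  have b₁ := logJap_nonneg (modu s₁ y)
  have b₂ := logJap_nonneg (modu s₂ z)
  rcases le_total (16 * ‖spt x‖) ‖spt y‖ with hc | hc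
  · refine (le_exp_mul_of_le hnull (kerLow_eq_exp (s := s₁) (t := s₂) hc) ?_).trans
      (mul_le_mul_right le_self_add _)
    refine exponent_low H (logJap_nonneg _)
      (logJap_mono (norm_nonneg _) (by linarith [norm_nonneg (spt x)])) ?_ ?_ b₁ b₂
    · rw [add_comm]
      exact logJap_le_add (norm_nonneg _) (c := 2)
        (by linarith [norm_nonneg (spt x)]) (by norm_num) two_le_exp_one
    · have := logJap_le_add (x := ‖spt y‖) (y := min ‖spt y‖ ‖spt z‖) (norm_nonneg _)
        (c := 2) ?_ (by norm_num) two_le_exp_one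
      · linarith
      · rcases min_choice ‖spt y‖ ‖spt z‖ with hmin | hmin <;> rw [hmin] <;>
          linarith [norm_nonneg (spt x), norm_nonneg (spt y)]
  · have hy : ‖spt y‖ ≤ 17 * ‖spt x‖ := by linarith [norm_nonneg (spt x)]
    have hz : ‖spt z‖ ≤ 17 * ‖spt x‖ := by linarith
    refine (le_exp_mul_of_le hnull (kerHigh_eq_exp (s := s₁) (t := s₂) hy hz) ?_).trans
      (mul_le_mul_right le_add_self _)
    refine exponent_high H ?_ ?_ (logJap_nonneg _) ?_ ?_ ?_ ?_ b₁ b₂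
    · exact logJap_mono (le_min (norm_nonneg _) (norm_nonneg _)) (min_le_left _ _)
    · exact logJap_mono (le_min (norm_nonneg _) (norm_nonneg _)) (min_le_right _ _)
    · rcases min_choice ‖spt y‖ ‖spt z‖ with hmin | hmin <;> rw [hmin] <;> simp
    · exact logJap_le_add (norm_nonneg _) hy (by norm_num) seventeen_le_exp_three
    · exact logJap_le_add (norm_nonneg _) hz (by norm_num) seventeen_le_exp_three
    · exact logJap_le_or_of_le_add (norm_nonneg _) t₀

theorem kerNull_le_of_second {s₀ s₁ s₂ l r ε : ℝ} (h₀ : |s₀| = 1) (h₁ : |s₁| = 1) (h₂ : |s₂| = 1)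
    (H : Admissible l r ε) {x y z : SpaceTime} (h : x + y + z = 0)
    (l₀ : logJap (modu s₀ x) ≤ logJap (modu s₁ y)) (l₂ : logJap (modu s₂ z) ≤ logJap (modu s₁ y)) :
    kerNull s₀ s₁ s₂ l r ε x y z ≤ ENNReal.ofReal (Real.exp (100 + 100 * l)) *
      (kerHigh s₁ s₂ ε x y z + kerLow s₂ s₀ ε y z x + kerHigh s₂ s₀ ε y z x) := by
  obtain ⟨t₀, t₁, t₂⟩ := norm_spt_triangle h
  have b₀ := logJap_nonneg (modu s₀ x)
  have b₁ := logJap_nonneg (modu s₁ y)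
  have b₂ := logJap_nonneg (modu s₂ z)
  have nx := norm_nonneg (spt x)
  have ny := norm_nonneg (spt y)
  have nz := norm_nonneg (spt z)
  rcases le_total (16 * ‖spt y‖) ‖spt z‖ with hc | hc
  · have hmin : min ‖spt y‖ ‖spt z‖ = ‖spt y‖ := min_eq_left (by linarith)
    obtain ⟨α, hα0, hα1, hα⟩ := exponent_mixed H (n₁ := logJap ‖spt y‖) (n₂ := logJap ‖spt z‖)
      (n₀ := logJap ‖spt x‖) (logJap_nonneg _) (logJap_mono ny (by linarith))
      (by rw [add_comm]
          exact logJap_le_add nx (c := 2) (by linarith) (by norm_num) two_le_exp_one)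
      (by rw [add_comm]
          exact logJap_le_add nz (c := 2) (by linarith) (by norm_num) two_le_exp_one)
      b₀ b₁ b₂
    have hnull := kerNull_le_exp (l := l) (r := r) (ε := ε) (a := 1 / 4 + α / 2) h₀ h₁ h₂
      (by linarith) (by linarith) h l₀ le_rfl l₂
    rw [hmin] at hnull
    rcases max_choice (-(1 / 2 + ε) * logJap ‖spt y‖ - 1 / 2 * logJap ‖spt z‖
      - (1 / 2 + ε) * logJap (modu s₂ z) - (1 / 2 + ε) * logJap (modu s₀ x))
      (-(1 + ε) * logJap ‖spt y‖ - (1 / 2 + ε) * logJap (modu s₁ y)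
      - (1 / 2 + ε) * logJap (modu s₂ z)) with hmax | hmax <;> rw [hmax] at hα
    · exact (le_exp_mul_of_le hnull (kerLow_eq_exp (s := s₂) (t := s₀) hc) hα).trans
        (mul_le_mul_right (le_add_self.trans le_self_add) _)
    · have hK := kerHigh_eq_exp (s := s₁) (t := s₂) (η := ε) (x := x) (y := y) (z := z)
        (by linarith) (by linarith)
      rw [hmin] at hK
      exact (le_exp_mul_of_le hnull hK hα).trans
        (mul_le_mul_right (le_self_add.trans le_self_add) _)
  · have hz : ‖spt z‖ ≤ 17 * ‖spt y‖ := by linarith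
    have hx : ‖spt x‖ ≤ 17 * ‖spt y‖ := by linarith
    have hnull := kerNull_le_exp (l := l) (r := r) (ε := ε) (a := 1 / 2) h₀ h₁ h₂
      (by norm_num) le_rfl h l₀ le_rfl l₂
    refine (le_exp_mul_of_le hnull (kerHigh_eq_exp (s := s₂) (t := s₀) hz hx) ?_).trans
      (mul_le_mul_right le_add_self _)
    refine exponent_far H (logJap_nonneg _) (logJap_nonneg _) ?_ ?_ ?_
      ?_ ?_ b₀ l₀ b₂
    · exact logJap_le_add nx hx (by norm_num) seventeen_le_exp_three
    · exact logJap_le_add nz hz (by norm_num) seventeen_le_exp_three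
    · have := logJap_le_add (x := ‖spt z‖) (y := min ‖spt y‖ ‖spt z‖) nz
        (c := 17) ?_ (by norm_num) seventeen_le_exp_three
      · linarith
      · rcases min_choice ‖spt y‖ ‖spt z‖ with hmin | hmin <;> rw [hmin] <;> linarith
    · exact logJap_mono (le_min nz nx) (min_le_right _ _)
    · exact logJap_mono (le_min nz nx) (min_le_left _ _)

theorem kerNull_le {s₀ s₁ s₂ l r ε : ℝ} (h₀ : |s₀| = 1) (h₁ : |s₁| = 1) (h₂ : |s₂| = 1)
    (H : Admissible l r ε) {x y z : SpaceTime} (h : x + y + z = 0) :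
    kerNull s₀ s₁ s₂ l r ε x y z ≤ ENNReal.ofReal (Real.exp (100 + 100 * l)) *
      ((kerLow s₁ s₂ ε x y z + kerHigh s₁ s₂ ε x y z) +
        (kerLow s₂ s₀ ε y z x + kerHigh s₂ s₀ ε y z x) +
        (kerLow s₁ s₀ ε z y x + kerHigh s₁ s₀ ε z y x)) := by
  have h' : x + z + y = 0 := by rw [← h]; abel
  rcases le_total (logJap (modu s₁ y)) (logJap (modu s₀ x)) with h₁₀ | h₀₁
  · rcases le_total (logJap (modu s₂ z)) (logJap (modu s₀ x)) with h₂₀ | h₀₂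
    · refine (kerNull_le_of_first h₀ h₁ h₂ H h h₁₀ h₂₀).trans (mul_le_mul_right ?_ _)
      exact le_self_add.trans le_self_add
    · rw [kerNull_swap]
      refine (kerNull_le_of_second h₀ h₂ h₁ H h' h₀₂ (h₁₀.trans h₀₂)).trans
        (mul_le_mul_right ?_ _)
      rw [kerHigh_swap, add_assoc]
      exact add_le_add_left (le_add_self.trans le_self_add) _
  · rcases le_total (logJap (modu s₂ z)) (logJap (modu s₁ y)) with h₂₁ | h₁₂
    · refine (kerNull_le_of_second h₀ h₁ h₂ H h h₀₁ h₂₁).trans (mul_le_mul_right ?_ _)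
      rw [add_assoc]
      exact (add_le_add_left le_add_self _).trans le_self_add
    · rw [kerNull_swap]
      refine (kerNull_le_of_second h₀ h₂ h₁ H h' (h₀₁.trans h₁₂) h₁₂).trans
        (mul_le_mul_right ?_ _)
      rw [kerHigh_swap, add_assoc]
      exact add_le_add_left (le_add_self.trans le_self_add) _

theorem triBdd_kerNull {s₀ s₁ s₂ l r ε : ℝ} (h₀ : |s₀| = 1) (h₁ : |s₁| = 1) (h₂ : |s₂| = 1)
    (H : Admissible l r ε) : TriBdd (kerNull s₀ s₁ s₂ l r ε) := by
  have hε := H.pos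
  have first : ∀ {s t : ℝ}, |s| = 1 → |t| = 1 →
      TriBdd fun x y z => kerLow s t ε x y z + kerHigh s t ε x y z := fun hs ht =>
    (triBdd_kerLow ht hε).add (triBdd_kerHigh hs ht hε) (meas3_kerLow _ _ _)
  have meas : ∀ s t : ℝ, Meas3 fun x y z => kerLow s t ε x y z + kerHigh s t ε x y z :=
    fun s t => (meas3_kerLow s t ε).add (meas3_kerHigh s t ε)
  have meas' : Meas3 fun x y z => kerLow s₂ s₀ ε y z x + kerHigh s₂ s₀ ε y z x :=
    (meas s₂ s₀).comp (measurable_fst.comp measurable_snd) (measurable_snd.comp measurable_snd)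
      measurable_fst
  have swapped : Meas3 fun x y z => kerLow s₁ s₀ ε x z y + kerHigh s₁ s₀ ε x z y :=
    (meas s₁ s₀).comp measurable_fst (measurable_snd.comp measurable_snd)
      (measurable_fst.comp measurable_snd)
  have swapped' : Meas3 fun x y z => kerLow s₁ s₀ ε y x z + kerHigh s₁ s₀ ε y x z :=
    (meas s₁ s₀).comp (measurable_fst.comp measurable_snd) measurable_fst
      (measurable_snd.comp measurable_snd)
  have second := (first h₂ h₀).cyc (meas s₂ s₀)
  have third := (((first h₁ h₀).swap (meas s₁ s₀)).cyc swapped).cyc swapped'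
  refine (((first h₁ h₂).add second (meas s₁ s₂)).add third
    ((meas s₁ s₂).add meas')).mono (Real.exp (100 + 100 * l)).toNNReal fun x y z h =>
      kerNull_le h₀ h₁ h₂ H h

theorem abs_sgnv (sg : Bool) : |sgnv sg| = 1 := by cases sg <;> simp [sgnv]

theorem measurable_angle {α : Type*} [MeasurableSpace α] {f g : α → Space} (hf : Measurable f)
    (hg : Measurable g) : Measurable fun x => InnerProductGeometry.angle (f x) (g x) := by
  unfold InnerProductGeometry.angle
  exact Real.continuous_arccos.measurable.comp
    ((hf.inner hg).div (hf.norm.mul hg.norm))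

theorem meas3_kerNull (s₀ s₁ s₂ l r ε : ℝ) : Meas3 (kerNull s₀ s₁ s₂ l r ε) := by
  have h : ∀ s : ℝ, Measurable (modu s) := fun s => (continuous_modu s).measurable
  unfold Meas3 kerNull
  refine ((measurable_angle (by fun_prop) (by fun_prop)).ennreal_ofReal).mul ?_
  fun_prop

theorem norm_spt_le (ζ : SpaceTime) : ‖spt ζ‖ ≤ ‖ζ‖ := by
  rw [EuclideanSpace.norm_eq, EuclideanSpace.norm_eq, Fin.sum_univ_succ (n := 3)]
  refine Real.sqrt_le_sqrt ?_
  have : ∑ i : Fin 3, ‖(spt ζ) i‖ ^ 2 = ∑ i : Fin 3, ‖ζ i.succ‖ ^ 2 := rfl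
  rw [this]
  exact le_add_of_nonneg_left (by positivity)

theorem continuous_xWt (sg : Bool) (s b : ℝ) : Continuous (xWt sg s b) := by
  have h := continuous_jap
  unfold xWt
  refine Continuous.mul ?_ ?_
  · exact (h.comp (by fun_prop)).rpow_const fun x => Or.inl (jap_pos _).ne'
  · exact (h.comp (by fun_prop)).rpow_const fun x => Or.inl (jap_pos _).ne'

theorem xWt_pos (sg : Bool) (s b : ℝ) (ζ : SpaceTime) : 0 < xWt sg s b ζ :=
  mul_pos (Real.rpow_pos_of_pos (jap_pos _) _) (Real.rpow_pos_of_pos (jap_pos _) _)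

theorem ofReal_xWt (sg : Bool) (s b : ℝ) (ζ : SpaceTime) : ENNReal.ofReal (xWt sg s b ζ) =
    japPow (-s) ‖spt ζ‖ * japPow (-b) (modu (sgnv sg) ζ) := by
  rw [xWt, ENNReal.ofReal_mul (Real.rpow_nonneg (jap_pos _).le _), japPow, japPow, neg_neg,
    neg_neg, modu]

theorem japPow_mul_japPow_neg (p x : ℝ) : japPow p x * japPow (-p) x = 1 := by
  rw [japPow, japPow, ← ENNReal.ofReal_mul (Real.rpow_nonneg (jap_pos _).le _),
    ← Real.rpow_add (jap_pos _)]
  simp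

/-- The weighted density whose `L²` norm is the `X^{s,b}` norm. -/
def xDens (sg : Bool) (s b : ℝ) (f : SpaceTime → ℂ) (ζ : SpaceTime) : ℝ≥0∞ :=
  ENNReal.ofReal (xWt sg s b ζ) * ‖f ζ‖ₑ

theorem measurable_xDens (sg : Bool) (s b : ℝ) {f : SpaceTime → ℂ} (hf : Continuous f) :
    Measurable (xDens sg s b f) :=
  (continuous_xWt sg s b).measurable.ennreal_ofReal.mul hf.measurable.enorm

theorem wnorm_xWt_eq (sg : Bool) (s b : ℝ) {f : SpaceTime → ℂ} (hf : Continuous f) :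
    wnorm (xWt sg s b) f = (l2n (xDens sg s b f)).toReal := by
  have hc := continuous_xWt sg s b
  rw [wnorm, integral_eq_lintegral_of_nonneg_ae (Filter.Eventually.of_forall fun x => by positivity)
    (by apply Continuous.aestronglyMeasurable; fun_prop), l2n, ← ENNReal.toReal_rpow]
  congr 2
  refine lintegral_congr fun x => ?_
  rw [xDens, ENNReal.ofReal_pow (mul_nonneg (xWt_pos _ _ _ _).le (norm_nonneg _)),
    ENNReal.ofReal_mul (xWt_pos _ _ _ _).le, ofReal_norm]

theorem xWt_le {sg : Bool} {s b : ℝ} (hs : 0 ≤ s) (hb : 0 ≤ b) (hb' : b ≤ 1) {n : ℕ}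
    (hn : s + 1 ≤ n) (ζ : SpaceTime) : xWt sg s b ζ ≤ (2 * (1 + ‖ζ‖)) ^ n := by
  have hsp := norm_spt_le ζ
  have h1 : jap ‖spt ζ‖ ≤ 2 * (1 + ‖ζ‖) :=
    (jap_le_one_add (norm_nonneg _)).trans (by linarith [norm_nonneg ζ])
  have h2 : jap (-(ζ 0) + sgnv sg * ‖spt ζ‖) ≤ 2 * (1 + ‖ζ‖) := by
    have h0 : |ζ 0| ≤ ‖ζ‖ := by simpa using PiLp.norm_apply_le ζ 0
    have h3 : |-(ζ 0) + sgnv sg * ‖spt ζ‖| ≤ 2 * ‖ζ‖ := by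
      refine (abs_add_le _ _).trans ?_
      rw [abs_neg, abs_mul, abs_sgnv, one_mul, abs_of_nonneg (norm_nonneg (spt ζ))]
      linarith
    have h4 : jap (-(ζ 0) + sgnv sg * ‖spt ζ‖) = jap |-(ζ 0) + sgnv sg * ‖spt ζ‖| := by
      simp [jap]
    rw [h4]
    exact (jap_le_one_add (abs_nonneg _)).trans (by linarith)
  have h5 : (1 : ℝ) ≤ 2 * (1 + ‖ζ‖) := by linarith [norm_nonneg ζ]
  calc xWt sg s b ζ ≤ (2 * (1 + ‖ζ‖)) ^ s * (2 * (1 + ‖ζ‖)) ^ b :=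
        mul_le_mul (Real.rpow_le_rpow (jap_pos _).le h1 hs) (Real.rpow_le_rpow (jap_pos _).le h2 hb)
          (Real.rpow_nonneg (jap_pos _).le _) (by positivity)
    _ = (2 * (1 + ‖ζ‖)) ^ (s + b) := (Real.rpow_add (by linarith) _ _).symm
    _ ≤ (2 * (1 + ‖ζ‖)) ^ (n : ℝ) := Real.rpow_le_rpow_of_exponent_le h5 (by linarith)
    _ = _ := Real.rpow_natCast _ _

theorem l2n_xDens_schwartz_ne_top {sg : Bool} {s b : ℝ} (hs : 0 ≤ s) (hb : 0 ≤ b) (hb' : b ≤ 1)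
    (u : SchwartzMap SpaceTime ℂ) : l2n (xDens sg s b u) ≠ ∞ := by
  obtain ⟨n, hn⟩ := exists_nat_ge (s + 1)
  obtain ⟨C, hC⟩ : ∃ C : ℝ, ∀ x, ‖u x‖ ≤ C :=
    ⟨_, fun x => by simpa using SchwartzMap.norm_le_seminorm ℝ u x⟩
  have hC0 : 0 ≤ C := (norm_nonneg _).trans (hC 0)
  have hint : Integrable fun ζ : SpaceTime =>
      4 ^ n * 2 ^ (2 * n - 1) * C * (‖u ζ‖ + ‖ζ‖ ^ (2 * n) * ‖u ζ‖) :=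
    (u.integrable.norm.add (u.integrable_pow_mul volume (2 * n))).const_mul _
  rw [l2n]
  refine ENNReal.rpow_ne_top_of_nonneg (by norm_num) (ne_top_of_le_ne_top hint.lintegral_lt_top.ne
    (lintegral_mono fun ζ => ?_))
  rw [xDens, ← ofReal_norm, ← ENNReal.ofReal_mul (xWt_pos _ _ _ _).le,
    ← ENNReal.ofReal_pow (mul_nonneg (xWt_pos _ _ _ _).le (norm_nonneg _))]
  refine ENNReal.ofReal_le_ofReal ?_
  have h1 : xWt sg s b ζ ^ 2 ≤ 4 ^ n * (2 ^ (2 * n - 1) * (1 + ‖ζ‖ ^ (2 * n))) := by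
    calc xWt sg s b ζ ^ 2 ≤ ((2 * (1 + ‖ζ‖)) ^ n) ^ 2 :=
          pow_le_pow_left₀ (xWt_pos _ _ _ _).le (xWt_le hs hb hb' hn ζ) 2
      _ = 4 ^ n * (1 + ‖ζ‖) ^ (2 * n) := by
          rw [mul_pow, mul_pow, ← pow_mul, ← pow_mul, mul_comm n 2, pow_mul 2 2 n]; norm_num
      _ ≤ _ := by
          have := add_pow_le zero_le_one (norm_nonneg ζ) (2 * n)
          rw [one_pow] at this
          gcongr
  have h2 : ‖u ζ‖ ^ 2 ≤ C * ‖u ζ‖ := by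
    rw [sq]; exact mul_le_mul_of_nonneg_right (hC ζ) (norm_nonneg _)
  calc (xWt sg s b ζ * ‖u ζ‖) ^ 2 = xWt sg s b ζ ^ 2 * ‖u ζ‖ ^ 2 := mul_pow _ _ _
    _ ≤ (4 ^ n * (2 ^ (2 * n - 1) * (1 + ‖ζ‖ ^ (2 * n)))) * (C * ‖u ζ‖) := by gcongr
    _ = _ := by ring

/-- The space-time Fourier transform of the null form, in terms of those of its arguments. -/
def nullConv (sg₁ sg₂ : Bool) (u v : SpaceTime → ℂ) (ζ : SpaceTime) : ℂ :=
  ∫ η, (angleWt sg₁ sg₂ η (ζ - η) : ℂ) * u η * v (ζ - η)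

theorem angleWt_nonneg (sg₁ sg₂ : Bool) (η θ : SpaceTime) : 0 ≤ angleWt sg₁ sg₂ η θ :=
  abs_nonneg _

theorem angleWt_eq (sg₁ sg₂ : Bool) (η θ : SpaceTime) : angleWt sg₁ sg₂ η θ =
    InnerProductGeometry.angle (sgnv sg₁ • spt η) (sgnv sg₂ • spt θ) :=
  abs_of_nonneg (InnerProductGeometry.angle_nonneg _ _)

theorem angleWt_le_pi (sg₁ sg₂ : Bool) (η θ : SpaceTime) : angleWt sg₁ sg₂ η θ ≤ Real.pi := by
  rw [angleWt_eq]
  exact InnerProductGeometry.angle_le_pi _ _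

theorem continuousAt_angleWt (sg₁ sg₂ : Bool) {η ζ : SpaceTime} (hη : spt η ≠ 0)
    (hζ : spt (ζ - η) ≠ 0) : ContinuousAt (fun x => angleWt sg₁ sg₂ η (x - η)) ζ := by
  have hs : ∀ sg : Bool, sgnv sg ≠ 0 := fun sg h => by simpa [h] using abs_sgnv sg
  simp only [angleWt_eq]
  exact (InnerProductGeometry.continuousAt_angle
    (x := (sgnv sg₁ • spt η, sgnv sg₂ • spt (ζ - η)))
    (smul_ne_zero (hs _) hη) (smul_ne_zero (hs _) hζ)).comp
    (f := fun x => (sgnv sg₁ • spt η, sgnv sg₂ • spt (x - η))) (by fun_prop)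

theorem norm_nullConv_integrand_le (sg₁ sg₂ : Bool) (u v : SpaceTime → ℂ) (ζ η : SpaceTime) :
    ‖(angleWt sg₁ sg₂ η (ζ - η) : ℂ) * u η * v (ζ - η)‖ ≤
      Real.pi * (‖u η‖ * ‖v (ζ - η)‖) := by
  rw [norm_mul, norm_mul, Complex.norm_real, Real.norm_of_nonneg (angleWt_nonneg _ _ _ _), mul_assoc]
  exact mul_le_mul_of_nonneg_right (angleWt_le_pi _ _ _ _) (by positivity)

theorem aestronglyMeasurable_nullConv_integrand (sg₁ sg₂ : Bool) {u v : SpaceTime → ℂ}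
    (hu : Continuous u) (hv : Continuous v) (ζ : SpaceTime) : AEStronglyMeasurable
      (fun η => (angleWt sg₁ sg₂ η (ζ - η) : ℂ) * u η * v (ζ - η)) := by
  have h : Measurable fun η => angleWt sg₁ sg₂ η (ζ - η) := by
    simp only [angleWt_eq]
    exact measurable_angle (by fun_prop) (by fun_prop)
  refine AEStronglyMeasurable.mul (AEStronglyMeasurable.mul ?_ hu.aestronglyMeasurable) ?_
  · exact (Complex.measurable_ofReal.comp h).aestronglyMeasurable
  · exact (hv.comp (by fun_prop)).aestronglyMeasurable

theorem continuous_nullConv (sg₁ sg₂ : Bool) (u v : SchwartzMap SpaceTime ℂ) :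
    Continuous (nullConv sg₁ sg₂ u v) := by
  obtain ⟨C, hC⟩ : ∃ C : ℝ, ∀ x, ‖v x‖ ≤ C :=
    ⟨_, fun x => by simpa using SchwartzMap.norm_le_seminorm ℝ v x⟩
  refine continuous_iff_continuousAt.2 fun ζ => ?_
  refine continuousAt_of_dominated (bound := fun η => Real.pi * (‖u η‖ * C))
    (Filter.Eventually.of_forall fun x =>
      aestronglyMeasurable_nullConv_integrand sg₁ sg₂ u.continuous v.continuous x)
    (Filter.Eventually.of_forall fun x => Filter.Eventually.of_forall fun η => ?_)
    ((u.integrable.norm.mul_const _).const_mul _) ?_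
  · refine (norm_nullConv_integrand_le sg₁ sg₂ u v x η).trans ?_
    gcongr
    exact hC _
  · filter_upwards [ae_spt_ne_zero,
      (quasiMeasurePreserving_sub_left volume ζ).ae ae_spt_ne_zero] with η h₁ h₂
    exact ((Complex.continuous_ofReal.continuousAt.comp (continuousAt_angleWt sg₁ sg₂ h₁ h₂)).mul
      continuousAt_const).mul (v.continuous.comp (by fun_prop)).continuousAt

theorem integrable_nullConv (sg₁ sg₂ : Bool) (u v : SchwartzMap SpaceTime ℂ) :
    Integrable (nullConv sg₁ sg₂ u v) := by
  have h := (u.integrable (μ := volume)).norm.integrable_convolution (ContinuousLinearMap.mul ℝ ℝ)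
    (v.integrable (μ := volume)).norm
  refine (h.const_mul Real.pi).mono' (continuous_nullConv _ _ _ _).aestronglyMeasurable
    (Filter.Eventually.of_forall fun ζ => ?_)
  rw [convolution_def, ← integral_const_mul]
  have hcv : Integrable fun η => Real.pi * (‖u η‖ * ‖v (ζ - η)‖) := by
    obtain ⟨C, hC⟩ : ∃ C : ℝ, ∀ x, ‖v x‖ ≤ C :=
      ⟨_, fun x => by simpa using SchwartzMap.norm_le_seminorm ℝ v x⟩
    refine ((u.integrable.norm.mul_const C).const_mul Real.pi).mono'
      (by apply Continuous.aestronglyMeasurable; have := u.continuous; have := v.continuous; fun_prop)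
      (Filter.Eventually.of_forall fun η => ?_)
    rw [Real.norm_of_nonneg (by positivity)]
    gcongr
    exact hC _
  exact (norm_integral_le_integral_norm _).trans (integral_mono_of_nonneg
    (Filter.Eventually.of_forall fun η => norm_nonneg _) hcv
    (Filter.Eventually.of_forall fun η => norm_nullConv_integrand_le sg₁ sg₂ u v ζ η))

theorem l2n_comp_neg (f : SpaceTime → ℝ≥0∞) : l2n (fun x => f (-x)) = l2n f := by
  rw [l2n, l2n, lintegral_neg_eq_self fun x => f x ^ 2]

theorem mul_xWt_mul_enorm_eq {sg₀ sg₁ sg₂ : Bool} {l r ε : ℝ} {u v : SpaceTime → ℂ}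
    (g : ℝ≥0∞) (ζ η : SpaceTime) :
    g * (ENNReal.ofReal (xWt sg₀ r (-(1 / 2) + 2 * ε) ζ) *
      ‖(angleWt sg₁ sg₂ η (ζ - η) : ℂ) * u η * v (ζ - η)‖ₑ) =
    kerNull (-sgnv sg₀) (sgnv sg₁) (sgnv sg₂) l r ε (-ζ) η (ζ - η) *
      (g * xDens sg₁ l (3 / 4 + ε) u η * xDens sg₂ l (3 / 4 + ε) v (ζ - η)) := by
  have hang : ‖(angleWt sg₁ sg₂ η (ζ - η) : ℂ)‖ₑ = ENNReal.ofReal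
      (InnerProductGeometry.angle (sgnv sg₁ • spt η) (sgnv sg₂ • spt (ζ - η))) := by
    rw [← ofReal_norm, Complex.norm_real, Real.norm_of_nonneg (angleWt_nonneg _ _ _ _),
      angleWt_eq]
  have hmod : japPow (1 / 2 - 2 * ε) (modu (-sgnv sg₀) (-ζ)) =
      japPow (-(-(1 / 2) + 2 * ε)) (modu (sgnv sg₀) ζ) := by
    rw [japPow, japPow, jap_modu_neg, neg_neg]
    congr 3
    ring
  rw [enorm_mul, enorm_mul, hang, kerNull, hmod, spt_neg, norm_neg, ofReal_xWt, xDens, xDens,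
    ofReal_xWt, ofReal_xWt]
  have e₁ := japPow_mul_japPow_neg l ‖spt η‖
  have e₂ := japPow_mul_japPow_neg l ‖spt (ζ - η)‖
  have e₃ := japPow_mul_japPow_neg (3 / 4 + ε) (modu (sgnv sg₁) η)
  have e₄ := japPow_mul_japPow_neg (3 / 4 + ε) (modu (sgnv sg₂) (ζ - η))
  set θ := ENNReal.ofReal
      (InnerProductGeometry.angle (sgnv sg₁ • spt η) (sgnv sg₂ • spt (ζ - η)))
  set j₀ := japPow (-r) ‖spt ζ‖
  set j₁ := japPow (-(-(1 / 2) + 2 * ε)) (modu (sgnv sg₀) ζ)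
  symm
  calc _ = (g * (j₀ * j₁ * (θ * ‖u η‖ₑ * ‖v (ζ - η)‖ₑ))) *
        (japPow l ‖spt η‖ * japPow (-l) ‖spt η‖) *
        (japPow l ‖spt (ζ - η)‖ * japPow (-l) ‖spt (ζ - η)‖) *
        (japPow (3 / 4 + ε) (modu (sgnv sg₁) η) * japPow (-(3 / 4 + ε)) (modu (sgnv sg₁) η)) *
        (japPow (3 / 4 + ε) (modu (sgnv sg₂) (ζ - η)) *
          japPow (-(3 / 4 + ε)) (modu (sgnv sg₂) (ζ - η))) := by ring
    _ = _ := by rw [e₁, e₂, e₃, e₄, mul_one, mul_one, mul_one, mul_one]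

theorem exists_l2n_nullConv_le {l r ε : ℝ} (H : Admissible l r ε) (sg₀ sg₁ sg₂ : Bool) :
    ∃ C : ℝ≥0, ∀ u v : SchwartzMap SpaceTime ℂ,
      l2n (xDens sg₀ r (-(1 / 2) + 2 * ε) (nullConv sg₁ sg₂ u v)) ≠ ∞ →
      l2n (xDens sg₀ r (-(1 / 2) + 2 * ε) (nullConv sg₁ sg₂ u v)) ≤
        C * (l2n (xDens sg₁ l (3 / 4 + ε) u) * l2n (xDens sg₂ l (3 / 4 + ε) v)) := by
  obtain ⟨C, hC⟩ := triBdd_kerNull (s₀ := -sgnv sg₀) (by rw [abs_neg, abs_sgnv]) (abs_sgnv sg₁)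
    (abs_sgnv sg₂) H
  refine ⟨C, fun u v hfin => ?_⟩
  set g := xDens sg₀ r (-(1 / 2) + 2 * ε) (nullConv sg₁ sg₂ u v) with hg
  have hgm : Measurable g := measurable_xDens _ _ _ (continuous_nullConv _ _ _ _)
  have hum := measurable_xDens sg₁ l (3 / 4 + ε) u.continuous
  have hvm := measurable_xDens sg₂ l (3 / 4 + ε) v.continuous
  have hgn : Measurable fun x => g (-x) := hgm.comp measurable_neg
  have key := hC (fun x => g (-x)) _ _ hgn hum hvm
  have hM := (meas3_kerNull (-sgnv sg₀) (sgnv sg₁) (sgnv sg₂) l r ε).mul_prod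
    hgn hum hvm
  have hsq : l2n g ^ 2 ≤ l2n g *
      (C * (l2n (xDens sg₁ l (3 / 4 + ε) u) * l2n (xDens sg₂ l (3 / 4 + ε) v))) := by
    calc l2n g ^ 2 = ∫⁻ ζ, g ζ ^ 2 := l2n_sq g
      _ ≤ ∫⁻ ζ, ∫⁻ η, kerNull (-sgnv sg₀) (sgnv sg₁) (sgnv sg₂) l r ε (-ζ) η (ζ - η) *
          (g ζ * xDens sg₁ l (3 / 4 + ε) u η * xDens sg₂ l (3 / 4 + ε) v (ζ - η)) := by
        refine lintegral_mono fun ζ => ?_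
        simp only [← mul_xWt_mul_enorm_eq]
        have hgt : g ζ ≠ ∞ := ENNReal.mul_ne_top ENNReal.ofReal_ne_top enorm_ne_top
        rw [lintegral_const_mul' _ _ hgt,
          lintegral_const_mul' _ _ ENNReal.ofReal_ne_top, sq]
        refine mul_le_mul_right ?_ _
        rw [hg, xDens]
        exact mul_le_mul_right (enorm_integral_le_lintegral_enorm _) _
      _ = tri (fun x y z => kerNull (-sgnv sg₀) (sgnv sg₁) (sgnv sg₂) l r ε x y z *
          (g (-x) * xDens sg₁ l (3 / 4 + ε) u y * xDens sg₂ l (3 / 4 + ε) v z)) := by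
        rw [tri_eq hM, ← lintegral_neg_eq_self]
        refine lintegral_congr fun a => lintegral_congr fun b => ?_
        simp only [neg_neg, neg_add_rev]
        rw [show -b + -a = -a - b by abel]
      _ ≤ C * (l2n (fun x => g (-x)) * l2n (xDens sg₁ l (3 / 4 + ε) u) *
          l2n (xDens sg₂ l (3 / 4 + ε) v)) := key
      _ = _ := by rw [l2n_comp_neg]; ring
  rcases eq_or_ne (l2n g) 0 with h0 | h0
  · rw [h0]; exact zero_le
  · rw [sq] at hsq
    exact (ENNReal.mul_le_mul_iff_right h0 hfin).1 hsq

theorem FT_FTinv_eq_or_eq_zero {F : SpaceTime → ℂ} (hc : Continuous F) (hF : Integrable F) :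
    FT (FTinv F) = F ∨ FT (FTinv F) = 0 := by
  by_cases h : Integrable (FTinv F)
  · left
    refine hc.fourier_fourierInv_eq hF ?_
    refine h.comp_neg.congr (Filter.Eventually.of_forall fun x => ?_)
    simp [FTinv, Real.fourierInv_eq_fourier_neg]
  · right
    funext ζ
    rw [FT, Real.fourier_eq, Pi.zero_apply]
    exact integral_undef fun h' => h ((Real.fourierIntegral_convergent_iff ζ).1 h')

theorem XsbNorm_schwartz (sg : Bool) (s b : ℝ) (ψ : SchwartzMap SpaceTime ℂ) :
    XsbNorm sg s b ψ = (l2n (xDens sg s b (𝓕 ψ : SchwartzMap SpaceTime ℂ))).toReal :=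
  wnorm_xWt_eq sg s b (𝓕 ψ : SchwartzMap SpaceTime ℂ).continuous

theorem Bop_schwartz (sg₁ sg₂ : Bool) (ψ₁ ψ₂ : SchwartzMap SpaceTime ℂ) : Bop sg₁ sg₂ ψ₁ ψ₂ =
    FTinv (nullConv sg₁ sg₂ (𝓕 ψ₁ : SchwartzMap SpaceTime ℂ) (𝓕 ψ₂ : SchwartzMap SpaceTime ℂ)) :=
  rfl

/-- the null form estimate
`‖B_{±₁,±₂}(ψ₁,ψ₂)‖_{X^{r,-1/2+2ε}_{±₀}} ≲ ‖ψ₁‖_{X^{l,3/4+ε}_{±₁}} ‖ψ₂‖_{X^{l,3/4+ε}_{±₂}}`. -/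
theorem dirac_current_null_form_estimate (l r : ℝ)
    (h1 : l ≥ r) (h2 : l + r ≥ 0) (h3 : 2*l - r > 1/2) (h4 : 3*l - 2*r > 3/4) :
    ∃ ε₀ > (0:ℝ), ∀ ε : ℝ, 0 < ε → ε < ε₀ →
      ∀ sg₀ sg₁ sg₂ : Bool, ∃ C > 0, ∀ ψ₁ ψ₂ : SchwartzMap SpaceTime ℂ,
        XsbNorm sg₀ r (-(1/2)+2*ε) (Bop sg₁ sg₂ ⇑ψ₁ ⇑ψ₂)
          ≤ C * XsbNorm sg₁ l (3/4+ε) ⇑ψ₁ * XsbNorm sg₂ l (3/4+ε) ⇑ψ₂ := by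
  obtain ⟨ε₀, hε₀, hadm⟩ : ∃ ε₀ > (0 : ℝ), ∀ ε : ℝ, 0 < ε → ε < ε₀ → Admissible l r ε := by
    refine ⟨min (1 / 20) (min ((2 * l - r - 1 / 2) / 3) (3 * l - 2 * r - 3 / 4)),
      lt_min (by norm_num) (lt_min (by linarith) (by linarith)), fun ε hε hlt => ?_⟩
    obtain ⟨e₁, e₂⟩ := lt_min_iff.1 hlt
    obtain ⟨e₂, e₃⟩ := lt_min_iff.1 e₂
    exact ⟨hε, e₁.le, by linarith, h1, h2, by linarith, by linarith⟩
  refine ⟨ε₀, hε₀, fun ε hε hlt sg₀ sg₁ sg₂ => ?_⟩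
  have H := hadm ε hε hlt
  obtain ⟨C, hC⟩ := exists_l2n_nullConv_le H sg₀ sg₁ sg₂
  refine ⟨C + 1, by positivity, fun ψ₁ ψ₂ => ?_⟩
  rw [XsbNorm_schwartz, XsbNorm_schwartz, XsbNorm, Bop_schwartz]
  generalize (𝓕 ψ₁ : SchwartzMap SpaceTime ℂ) = u
  generalize (𝓕 ψ₂ : SchwartzMap SpaceTime ℂ) = v
  have hfin : ∀ (sg : Bool) (u : SchwartzMap SpaceTime ℂ), l2n (xDens sg l (3 / 4 + ε) u) ≠ ∞ :=
    fun sg u => l2n_xDens_schwartz_ne_top (by linarith [H.low]) (by linarith)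
      (by linarith [H.small]) u
  have hcont := continuous_nullConv sg₁ sg₂ u v
  rcases FT_FTinv_eq_or_eq_zero hcont (integrable_nullConv sg₁ sg₂ u v) with h | h
  · rw [h, wnorm_xWt_eq _ _ _ hcont]
    by_cases htop : l2n (xDens sg₀ r (-(1 / 2) + 2 * ε) (nullConv sg₁ sg₂ u v)) = ∞
    · rw [htop, ENNReal.toReal_top]
      positivity
    · have hle := ENNReal.toReal_mono (ENNReal.mul_ne_top ENNReal.coe_ne_top
        (ENNReal.mul_ne_top (hfin sg₁ u) (hfin sg₂ v))) (hC u v htop)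
      rw [ENNReal.toReal_mul, ENNReal.toReal_mul, ENNReal.coe_toReal, ← mul_assoc] at hle
      refine hle.trans ?_
      gcongr
      linarith
  · have h0 : wnorm (xWt sg₀ r (-(1 / 2) + 2 * ε)) (0 : SpaceTime → ℂ) = 0 := by
      simp [wnorm]
    rw [h, h0]
    positivity
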